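/- arXiv:0901.2163 — 14 statements merged into one kernel-verified Lean document; each statement's English description precedes it below -/
import Mathlib

section
/- Every solution v : ℤ → ℂ^n of the recursion k·v(k) + N·v(k) + E·v(k−1) = 0 (for all k ∈ ℤ) satisfies v(k) = 0 for every k < 0. -/
/-- Every doubly-infinite formal solution of the Frenkel–Gross recursion for the
standard representation of SL_n has vanishing coefficients in negative degrees. -/
theorem stmt_1 (n : ℕ) (hn : 2 ≤ n)
    (N E : Matrix (Fin n) (Fin n) ℂ)
    (hNdef : ∀ i j : Fin n, N i j = if (i : ℕ) = (j : ℕ) + 1 then 1 else 0)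
    (hEdef : ∀ i j : Fin n, E i j = if (i : ℕ) = 0 ∧ (j : ℕ) = n - 1 then 1 else 0)
    (v : ℤ → Fin n → ℂ)
    (hv : ∀ k : ℤ, (k : ℂ) • v k + N.mulVec (v k) + E.mulVec (v (k - 1)) = 0) :
    ∀ k : ℤ, k < 0 → v k = 0 := by
  have h0 : ∀ k : ℤ, (k : ℂ) * v k ⟨0, by omega⟩ + v (k - 1) ⟨n - 1, by omega⟩ = 0 := by
    intro k
    have h := congrFun (hv k) ⟨0, by omega⟩
    simp only [Pi.add_apply, Pi.smul_apply, smul_eq_mul, Matrix.mulVec, dotProduct, hNdef, hEdef,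
      Pi.zero_apply] at h
    rw [Finset.sum_eq_zero (by intro j _; simp),
      Finset.sum_eq_single (⟨n - 1, by omega⟩ : Fin n)] at h
    · simpa using h
    · intro j _ hj
      have : (j : ℕ) ≠ n - 1 := fun e => hj (Fin.ext e)
      simp [this]
    · simp
  have h1 : ∀ k : ℤ, ∀ i : ℕ, ∀ hi : i + 1 < n,
      (k : ℂ) * v k ⟨i + 1, hi⟩ + v k ⟨i, by omega⟩ = 0 := by
    intro k i hi
    have h := congrFun (hv k) ⟨i + 1, hi⟩
    simp only [Pi.add_apply, Pi.smul_apply, smul_eq_mul, Matrix.mulVec, dotProduct, hNdef, hEdef,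
      Pi.zero_apply] at h
    rw [Finset.sum_eq_single (⟨i, by omega⟩ : Fin n),
      Finset.sum_eq_zero (by intro j _; simp)] at h
    · simpa using h
    · intro j _ hj
      have : i ≠ (j : ℕ) := fun e => hj (Fin.ext e.symm)
      simp [this]
    · simp
  -- vanishing of the last coordinate forces vanishing of all coordinates
  have h2 : ∀ k : ℤ, v k ⟨n - 1, by omega⟩ = 0 → v k = 0 := by
    intro k hk
    have key : ∀ d : ℕ, ∀ hd : d < n, v k ⟨n - 1 - d, by omega⟩ = 0 := by
      intro d
      induction d with
      | zero => intro _; exact hk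
      | succ d ih =>
        intro hd
        have h := h1 k (n - 1 - (d + 1)) (by omega)
        have e : (⟨n - 1 - (d + 1) + 1, by omega⟩ : Fin n) = ⟨n - 1 - d, by omega⟩ :=
          Fin.ext (by simp only; omega)
        rw [e, ih (by omega)] at h
        simpa using h
    funext i
    have h := key (n - 1 - i) (by omega)
    have e : (⟨n - 1 - (n - 1 - (i : ℕ)), by omega⟩ : Fin n) = i :=
      Fin.ext (by simp only; omega)
    rw [e] at h
    exact h
  have h3 : ∀ m : ℕ, v (-(m : ℤ) - 1) = 0 := by
    intro m
    induction m with
    | zero =>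
      apply h2
      simpa using h0 0
    | succ m ih =>
      apply h2
      have h := h0 (-(m : ℤ) - 1)
      rw [ih] at h
      have e : -((m + 1 : ℕ) : ℤ) - 1 = -(m : ℤ) - 1 - 1 := by push_cast; ring
      rw [e]
      simpa using h
  intro k hk
  have h := h3 (-k - 1).toNat
  have e : -(((-k - 1).toNat : ℕ) : ℤ) - 1 = k := by omega
  rwa [e] at h
end

section
/- The set of solutions v : ℤ → ℂ^n of the recursion k·v(k) + N·v(k) + E·v(k−1) = 0 is a complex vector space on which the evaluation map v ↦ v(0) is a linear isomorphism onto the line ℂ·e_n spanned by the last standard basis vector e_n (the kernel of N); in particular the solution space is one-dimensional. -/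
/-- The space of doubly-infinite formal solutions of the Frenkel–Gross recursion,
as a submodule of ℤ → ℂ^n (cut out by the linear conditions
k·v(k) + N·v(k) + E·v(k−1) = 0 for all k). -/
noncomputable def fgSolSpace (n : ℕ) (N E : Matrix (Fin n) (Fin n) ℂ) :
    Submodule ℂ (ℤ → Fin n → ℂ) :=
  ⨅ k : ℤ, LinearMap.ker
    ((k : ℂ) • (LinearMap.proj k : (ℤ → Fin n → ℂ) →ₗ[ℂ] (Fin n → ℂ))
      + N.mulVecLin.comp (LinearMap.proj k)
      + E.mulVecLin.comp (LinearMap.proj (k - 1)))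

theorem fg_mem (n : ℕ) (N E : Matrix (Fin n) (Fin n) ℂ) (v : ℤ → Fin n → ℂ) :
    v ∈ fgSolSpace n N E ↔
        ∀ k : ℤ, (k : ℂ) • v k + N.mulVec (v k) + E.mulVec (v (k - 1)) = 0 := by
  simp [fgSolSpace, Submodule.mem_iInf]

theorem fg_coord (n : ℕ) (hz : 0 < n) (hl : n - 1 < n)
    (N E : Matrix (Fin n) (Fin n) ℂ)
    (hNdef : ∀ i j : Fin n, N i j = if (i : ℕ) = (j : ℕ) + 1 then 1 else 0)
    (hEdef : ∀ i j : Fin n, E i j = if (i : ℕ) = 0 ∧ (j : ℕ) = n - 1 then 1 else 0)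
    (v : ℤ → Fin n → ℂ) :
    v ∈ fgSolSpace n N E ↔
      ∀ k : ℤ, ((k : ℂ) * v k ⟨0, hz⟩ + v (k - 1) ⟨n - 1, hl⟩ = 0) ∧
        ∀ (i : ℕ) (hi : i + 1 < n),
          (k : ℂ) * v k ⟨i + 1, hi⟩ + v k ⟨i, Nat.lt_of_succ_lt hi⟩ = 0 := by
  have hN0 : ∀ w : Fin n → ℂ, N.mulVec w ⟨0, by omega⟩ = 0 := by
    intro w
    simp [Matrix.mulVec, dotProduct, hNdef]
  have hN1 : ∀ (w : Fin n → ℂ) (i : ℕ) (hi : i + 1 < n),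
      N.mulVec w ⟨i + 1, hi⟩ = w ⟨i, by omega⟩ := by
    intro w i hi
    rw [Matrix.mulVec, dotProduct, Finset.sum_eq_single (⟨i, by omega⟩ : Fin n)]
    · simp [hNdef]
    · intro b _ hb
      have : i ≠ (b : ℕ) := fun h => hb (Fin.ext h.symm)
      simp [hNdef, this]
    · simp
  have hE0 : ∀ w : Fin n → ℂ, E.mulVec w ⟨0, by omega⟩ = w ⟨n - 1, by omega⟩ := by
    intro w
    rw [Matrix.mulVec, dotProduct, Finset.sum_eq_single (⟨n - 1, by omega⟩ : Fin n)]
    · simp [hEdef]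
    · intro b _ hb
      have : (b : ℕ) ≠ n - 1 := fun h => hb (Fin.ext h)
      simp [hEdef, this]
    · simp
  have hE1 : ∀ (w : Fin n → ℂ) (i : ℕ) (hi : i + 1 < n),
      E.mulVec w ⟨i + 1, hi⟩ = 0 := by
    intro w i hi
    simp [Matrix.mulVec, dotProduct, hEdef]
  rw [fg_mem]
  refine forall_congr' fun k => ⟨fun h => ⟨?_, fun i hi => ?_⟩, fun h => ?_⟩
  · have := congrFun h ⟨0, by omega⟩
    simpa [hN0, hE0] using this
  · have := congrFun h ⟨i + 1, hi⟩
    simpa [hN1, hE1] using this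
  · ext ⟨i, hi⟩
    cases i with
    | zero => simpa [hN0, hE0] using h.1
    | succ i => simpa [hN1, hE1] using h.2 i hi

/-- The sequence `(-1)^k / k!`, extended by zero to negative integers. -/
noncomputable def fgA (k : ℤ) : ℂ :=
  if 0 ≤ k then (-1) ^ k.toNat / (k.toNat.factorial : ℂ) else 0

theorem fgA_rec (k : ℤ) : (k : ℂ) * fgA k + fgA (k - 1) = 0 := by
  rcases lt_trichotomy k 0 with h | h | h
  · simp [fgA, show ¬ (0 ≤ k) by omega, show ¬ (1 ≤ k) by omega]
  · subst h
    simp [fgA]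
  · obtain ⟨m, rfl⟩ : ∃ m : ℕ, k = m + 1 := ⟨(k - 1).toNat, by omega⟩
    have h1 : ((m : ℤ) + 1).toNat = m + 1 := by omega
    have h2 : (0 : ℤ) ≤ m + 1 := by omega
    have h3 : ((m.factorial : ℕ) : ℂ) ≠ 0 := by exact_mod_cast m.factorial_ne_zero
    have h4 : (m : ℂ) + 1 ≠ 0 := by exact_mod_cast m.succ_ne_zero
    simp only [fgA, h1, h2, if_true, add_sub_cancel_right, Int.natCast_nonneg, Int.toNat_natCast,
      Nat.factorial_succ]
    push_cast
    field_simp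
    ring

/-- For the standard representation of SL_n, the solution space of the
Frenkel–Gross recursion is mapped by evaluation at 0 linearly and isomorphically
onto the line spanned by the last standard basis vector (the kernel of N);
in particular the solution space is one-dimensional. -/
theorem stmt_2 (n : ℕ) (hn : 2 ≤ n)
    (N E : Matrix (Fin n) (Fin n) ℂ)
    (hNdef : ∀ i j : Fin n, N i j = if (i : ℕ) = (j : ℕ) + 1 then 1 else 0)
    (hEdef : ∀ i j : Fin n, E i j = if (i : ℕ) = 0 ∧ (j : ℕ) = n - 1 then 1 else 0) :
    (∀ v : ℤ → Fin n → ℂ, v ∈ fgSolSpace n N E ↔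
        ∀ k : ℤ, (k : ℂ) • v k + N.mulVec (v k) + E.mulVec (v (k - 1)) = 0)
    ∧ Function.Injective
        (((LinearMap.proj (0 : ℤ) : (ℤ → Fin n → ℂ) →ₗ[ℂ] (Fin n → ℂ))).comp
          (fgSolSpace n N E).subtype)
    ∧ LinearMap.range
        (((LinearMap.proj (0 : ℤ) : (ℤ → Fin n → ℂ) →ₗ[ℂ] (Fin n → ℂ))).comp
          (fgSolSpace n N E).subtype)
        = Submodule.span ℂ {Pi.single (⟨n - 1, by omega⟩ : Fin n) (1 : ℂ)}
    ∧ Module.finrank ℂ (fgSolSpace n N E) = 1 := by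
  have hc := fg_coord n (by omega) (by omega) N E hNdef hEdef
  have hinj : Function.Injective
        (((LinearMap.proj (0 : ℤ) : (ℤ → Fin n → ℂ) →ₗ[ℂ] (Fin n → ℂ))).comp
          (fgSolSpace n N E).subtype) := by
    rw [injective_iff_map_eq_zero]
    rintro ⟨v, hv⟩ h0
    have h0 : v 0 = 0 := h0
    have h := (hc v).1 hv
    have key : ∀ k : ℤ, v k = 0 := by
      intro k
      induction k with
      | zero => exact h0
      | succ k ih =>
        have hk : (((k : ℤ) + 1 : ℤ) : ℂ) ≠ 0 := by
          exact_mod_cast k.succ_ne_zero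
        obtain ⟨ha, hb⟩ := h ((k : ℤ) + 1)
        have : ∀ (i : ℕ) (hi : i < n), v ((k : ℤ) + 1) ⟨i, hi⟩ = 0 := by
          intro i
          induction i with
          | zero =>
            intro hi
            rw [add_sub_cancel_right, ih, Pi.zero_apply, add_zero] at ha
            exact (mul_eq_zero.1 ha).resolve_left hk
          | succ i ihi =>
            intro hi
            have := hb i hi
            rw [ihi, add_zero] at this
            exact (mul_eq_zero.1 this).resolve_left hk
        ext ⟨i, hi⟩
        exact this i hi
      | pred k ih =>
        have hl : v (-(k : ℤ) - 1) ⟨n - 1, by omega⟩ = 0 := by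
          have := (h (-(k : ℤ))).1
          rwa [ih, Pi.zero_apply, mul_zero, zero_add] at this
        have hb := (h (-(k : ℤ) - 1)).2
        have : ∀ (j i : ℕ) (hi : i < n), i + j = n - 1 → v (-(k : ℤ) - 1) ⟨i, hi⟩ = 0 := by
          intro j
          induction j with
          | zero =>
            intro i hi hij
            have : i = n - 1 := hij
            subst this
            exact hl
          | succ j ihj =>
            intro i hi hij
            have := hb i (by omega)
            rwa [ihj (i + 1) (by omega) (by omega), mul_zero, zero_add] at this
        ext ⟨i, hi⟩
        exact this (n - 1 - i) i hi (by omega)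
    exact Subtype.ext (funext key)
  have hrange : LinearMap.range
        (((LinearMap.proj (0 : ℤ) : (ℤ → Fin n → ℂ) →ₗ[ℂ] (Fin n → ℂ))).comp
          (fgSolSpace n N E).subtype)
        = Submodule.span ℂ {Pi.single (⟨n - 1, by omega⟩ : Fin n) (1 : ℂ)} := by
    apply le_antisymm
    · rintro _ ⟨⟨v, hv⟩, rfl⟩
      rw [Submodule.mem_span_singleton]
      refine ⟨v 0 ⟨n - 1, by omega⟩, ?_⟩
      change _ = v 0
      ext ⟨i, hi⟩
      by_cases hin : i = n - 1
      · subst hin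
        simp
      · have := ((hc v).1 hv 0).2 i (by omega)
        simp only [Int.cast_zero, zero_mul, zero_add] at this
        rw [this]
        simp [hin]
    · rw [Submodule.span_singleton_le_iff_mem]
      refine ⟨⟨fun k i => fgA k ^ ((i : ℕ) + 1) * fgA (k - 1) ^ (n - 1 - (i : ℕ)), ?_⟩, ?_⟩
      · rw [hc]
        intro k
        have hr := fgA_rec k
        refine ⟨?_, fun i hi => ?_⟩
        · obtain ⟨m, rfl⟩ : ∃ m, n = m + 1 := ⟨n - 1, by omega⟩
          simp only [add_tsub_cancel_right, Nat.sub_self, Nat.sub_zero]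
          linear_combination fgA (k - 1) ^ m * hr
        · obtain ⟨m, rfl⟩ : ∃ m, n = i + m + 2 := ⟨n - (i + 2), by omega⟩
          simp only [show i + m + 2 - 1 - (i + 1) = m by omega,
            show i + m + 2 - 1 - i = m + 1 by omega]
          linear_combination fgA k ^ (i + 1) * fgA (k - 1) ^ m * hr
      · change (fun i : Fin n => fgA 0 ^ ((i : ℕ) + 1) * fgA (0 - 1) ^ (n - 1 - (i : ℕ))) = _
        have h0 : fgA 0 = 1 := by simp [fgA]
        have h1 : fgA (0 - 1) = 0 := by simp [fgA]
        ext ⟨i, hi⟩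
        rw [h0, h1]
        by_cases hin : i = n - 1
        · subst hin
          simp
        · have : n - 1 - i ≠ 0 := by omega
          simp [hin, this]
  refine ⟨fg_mem n N E, hinj, hrange, ?_⟩
  rw [(LinearEquiv.ofInjective _ hinj).finrank_eq, hrange]
  apply finrank_span_singleton
  intro h
  have := congrFun h ⟨n - 1, by omega⟩
  simp at this
end

section
/- If v : ℤ → ℂ^n is a solution of the recursion k·v(k) + N·v(k) + E·v(k−1) = 0 and there exists an integer K such that v(k) = 0 for all k ≥ K, then v(k) = 0 for all k ∈ ℤ. In particular, the only solution with finitely many nonzero values is the zero solution. -/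
/-- A solution of the Frenkel–Gross recursion (standard representation of SL_n)
whose coefficients vanish for all sufficiently large degrees vanishes identically;
in particular the only solution with finitely many nonzero values is zero. -/
theorem stmt_3 (n : ℕ) (hn : 2 ≤ n)
    (N E : Matrix (Fin n) (Fin n) ℂ)
    (hNdef : ∀ i j : Fin n, N i j = if (i : ℕ) = (j : ℕ) + 1 then 1 else 0)
    (hEdef : ∀ i j : Fin n, E i j = if (i : ℕ) = 0 ∧ (j : ℕ) = n - 1 then 1 else 0)
    (v : ℤ → Fin n → ℂ)
    (hv : ∀ k : ℤ, (k : ℂ) • v k + N.mulVec (v k) + E.mulVec (v (k - 1)) = 0)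
    (hfin : ∃ K : ℤ, ∀ k : ℤ, K ≤ k → v k = 0) :
    ∀ k : ℤ, v k = 0 := by
  have step : ∀ k : ℤ, v (k + 1) = 0 → v k = 0 := by
    intro k hk
    have key : ∀ m : ℕ, ∀ i : Fin n, (i : ℕ) + m = n - 1 → v k i = 0 := by
      intro m
      induction m with
      | zero =>
        intro i hi
        have h := congrFun (hv (k + 1)) ⟨0, by omega⟩
        rw [hk] at h
        simp only [add_sub_cancel_right, smul_zero, Matrix.mulVec_zero, zero_add,
          Pi.zero_apply, Matrix.mulVec, dotProduct, hEdef] at h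
        rw [Finset.sum_eq_single i] at h
        · have hi' : (i : ℕ) = n - 1 := by omega
          simpa [hi'] using h
        · intro j _ hj
          have : (j : ℕ) ≠ n - 1 := fun hj' => hj (Fin.ext (by omega))
          simp [this]
        · simp
      | succ m ih =>
        intro i hi
        have h := congrFun (hv k) ⟨i + 1, by omega⟩
        have h1 := ih ⟨i + 1, by omega⟩ (by simp only; omega)
        simp only [Pi.add_apply, Pi.smul_apply, h1, smul_zero, zero_add,
          Pi.zero_apply, Matrix.mulVec, dotProduct, hEdef, hNdef] at h
        rw [Finset.sum_eq_single i] at h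
        · simpa using h
        · intro j _ hj
          have : (i : ℕ) ≠ j := fun hj' => hj (Fin.ext (by omega))
          simp [this]
        · simp
    funext i
    exact key (n - 1 - i) i (by omega)
  obtain ⟨K, hK⟩ := hfin
  have down : ∀ m : ℕ, v (K - m) = 0 := by
    intro m
    induction m with
    | zero => exact hK _ (by simp)
    | succ m ih =>
      apply step
      have : K - ((m + 1 : ℕ) : ℤ) + 1 = K - m := by push_cast; ring
      rw [this]; exact ih
  intro k
  rcases le_total K k with h | h
  · exact hK k h
  · have := down (K - k).toNat
    rwa [show K - ((K - k).toNat : ℤ) = k by omega] at this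
end

section
/- Every solution v : ℤ → ℂ^{2n+1} of the recursion k·v(k) + N·v(k) + E·v(k−1) = 0 (for all k ∈ ℤ) satisfies v(k) = 0 for every k < 0. -/
/-- Every doubly-infinite formal solution of the Frenkel–Gross recursion for the
standard representation of SO_{2n+1} has vanishing coefficients in negative degrees. -/
theorem stmt_4 (n : ℕ) (hn : 1 ≤ n)
    (N E : Matrix (Fin (2 * n + 1)) (Fin (2 * n + 1)) ℂ)
    (hNdef : ∀ i j : Fin (2 * n + 1), N i j = if (i : ℕ) = (j : ℕ) + 1 then 1 else 0)
    (hEdef : ∀ i j : Fin (2 * n + 1), E i j =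
      if ((i : ℕ) = 0 ∧ (j : ℕ) = 2 * n - 1) ∨ ((i : ℕ) = 1 ∧ (j : ℕ) = 2 * n)
      then 1 else 0)
    (v : ℤ → Fin (2 * n + 1) → ℂ)
    (hv : ∀ k : ℤ, (k : ℂ) • v k + N.mulVec (v k) + E.mulVec (v (k - 1)) = 0) :
    ∀ k : ℤ, k < 0 → v k = 0 := by
  -- the three kinds of rows
  have hN : ∀ (u : Fin (2 * n + 1) → ℂ) (i j : Fin (2 * n + 1)), (i : ℕ) = (j : ℕ) + 1 →
      N.mulVec u i = u j := by
    intro u i j hij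
    simp only [Matrix.mulVec, dotProduct]
    rw [Finset.sum_eq_single j]
    · rw [hNdef, if_pos hij, one_mul]
    · intro b _ hb
      rw [hNdef, if_neg, zero_mul]
      intro h
      exact hb (Fin.ext (by omega))
    · simp
  have hN0 : ∀ (u : Fin (2 * n + 1) → ℂ) (i : Fin (2 * n + 1)), (i : ℕ) = 0 →
      N.mulVec u i = 0 := by
    intro u i hi
    simp only [Matrix.mulVec, dotProduct]
    refine Finset.sum_eq_zero fun b _ => ?_
    rw [hNdef, if_neg (by omega), zero_mul]
  have hE : ∀ (u : Fin (2 * n + 1) → ℂ) (i j : Fin (2 * n + 1)),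
      (((i : ℕ) = 0 ∧ (j : ℕ) = 2 * n - 1) ∨ ((i : ℕ) = 1 ∧ (j : ℕ) = 2 * n)) →
      E.mulVec u i = u j := by
    intro u i j hij
    simp only [Matrix.mulVec, dotProduct]
    rw [Finset.sum_eq_single j]
    · rw [hEdef, if_pos hij, one_mul]
    · intro b _ hb
      rw [hEdef, if_neg, zero_mul]
      intro h
      exact hb (Fin.ext (by omega))
    · simp
  have hE0 : ∀ (u : Fin (2 * n + 1) → ℂ) (i : Fin (2 * n + 1)), 2 ≤ (i : ℕ) →
      E.mulVec u i = 0 := by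
    intro u i hi
    simp only [Matrix.mulVec, dotProduct]
    refine Finset.sum_eq_zero fun b _ => ?_
    rw [hEdef, if_neg (by omega), zero_mul]
  have hrow : ∀ (k : ℤ) (i : Fin (2 * n + 1)),
      (k : ℂ) * v k i + N.mulVec (v k) i + E.mulVec (v (k - 1)) i = 0 := by
    intro k i
    have := congrFun (hv k) i
    simpa using this
  have r0 : ∀ k : ℤ, (k : ℂ) * v k ⟨0, by omega⟩ + v (k - 1) ⟨2 * n - 1, by omega⟩ = 0 := by
    intro k
    have := hrow k ⟨0, by omega⟩
    rw [hN0 _ _ rfl, hE _ _ ⟨2 * n - 1, by omega⟩ (Or.inl ⟨rfl, rfl⟩), add_zero] at this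
    exact this
  have r1 : ∀ k : ℤ, (k : ℂ) * v k ⟨1, by omega⟩ + v k ⟨0, by omega⟩
      + v (k - 1) ⟨2 * n, by omega⟩ = 0 := by
    intro k
    have := hrow k ⟨1, by omega⟩
    rw [hN _ _ ⟨0, by omega⟩ rfl, hE _ _ ⟨2 * n, by omega⟩ (Or.inr ⟨rfl, rfl⟩)] at this
    exact this
  have r2 : ∀ (k : ℤ) (i j : Fin (2 * n + 1)), 2 ≤ (i : ℕ) → (i : ℕ) = (j : ℕ) + 1 →
      (k : ℂ) * v k i + v k j = 0 := by
    intro k i j hi hij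
    have := hrow k i
    rw [hN _ _ j hij, hE0 _ _ hi, add_zero] at this
    exact this
  have rl : ∀ k : ℤ, (k : ℂ) * v k ⟨2 * n, by omega⟩ + v k ⟨2 * n - 1, by omega⟩ = 0 :=
    fun k => r2 k _ _ (by simp; omega) (by simp; omega)
  -- vanishing of the last coordinate propagates to all positive indices
  have prop : ∀ k : ℤ, v k ⟨2 * n, by omega⟩ = 0 →
      ∀ (d : ℕ) (j : Fin (2 * n + 1)), (j : ℕ) + d = 2 * n → 1 ≤ (j : ℕ) → v k j = 0 := by
    intro k hk d
    induction d with
    | zero =>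
      intro j hj _
      have : j = ⟨2 * n, by omega⟩ := Fin.ext (by simpa using hj)
      rw [this, hk]
    | succ d ih =>
      intro j hj h1
      have h := r2 k ⟨(j : ℕ) + 1, by omega⟩ j (by simp; omega) rfl
      rw [ih _ (by simp; omega) (by simp)] at h
      simpa using h
  have step : ∀ k : ℤ, k < 0 → v k ⟨2 * n, by omega⟩ = 0 →
      v k ⟨0, by omega⟩ = 0 ∧ v (k - 1) ⟨2 * n, by omega⟩ = 0 := by
    intro k hk ha
    have h1 := r1 k
    rw [prop k ha (2 * n - 1) ⟨1, by omega⟩ (by simp; omega) (by simp)] at h1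
    have h0 := r0 k
    have hl := rl (k - 1)
    have hz : ((2 * k - 1 : ℤ) : ℂ) ≠ 0 := by
      exact_mod_cast (by omega : (2 * k - 1 : ℤ) ≠ 0)
    have hm : ((2 * k - 1 : ℤ) : ℂ) * v (k - 1) ⟨2 * n, by omega⟩ = 0 := by
      push_cast at hl ⊢
      linear_combination hl - h0 + (k : ℂ) * h1
    have hb := (mul_eq_zero.mp hm).resolve_left hz
    refine ⟨?_, hb⟩
    rw [hb] at h1
    simpa using h1
  have last : ∀ m : ℕ, v (-1 - (m : ℤ)) ⟨2 * n, by omega⟩ = 0 := by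
    intro m
    induction m with
    | zero =>
      have h0 := r0 0
      have hl := rl (-1)
      simp only [Int.cast_zero, zero_mul, zero_add, zero_sub] at h0
      rw [h0] at hl
      simpa using hl
    | succ m ih =>
      have := (step _ (by omega) ih).2
      rw [show (-1 - ((m + 1 : ℕ) : ℤ)) = -1 - (m : ℤ) - 1 by push_cast; ring]
      exact this
  intro k hk
  have ha : v k ⟨2 * n, by omega⟩ = 0 := by
    have := last (-1 - k).toNat
    rwa [show -1 - (((-1 - k).toNat : ℕ) : ℤ) = k by omega] at this
  funext j
  rcases Nat.eq_zero_or_pos (j : ℕ) with hj | hj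
  · have : j = ⟨0, by omega⟩ := Fin.ext hj
    rw [this, (step k hk ha).1]
    rfl
  · exact prop k ha (2 * n - j) j (by omega) hj
end

section
/- If v : ℤ → ℂ^{2n+1} is a solution of the recursion k·v(k) + N·v(k) + E·v(k−1) = 0 and there exists an integer K such that v(k) = 0 for all k ≥ K, then v(k) = 0 for all k ∈ ℤ. -/
/-- A solution of the Frenkel–Gross recursion (standard representation of SO_{2n+1})
whose coefficients vanish for all sufficiently large degrees vanishes identically. -/
theorem stmt_6 (n : ℕ) (hn : 1 ≤ n)
    (N E : Matrix (Fin (2 * n + 1)) (Fin (2 * n + 1)) ℂ)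
    (hNdef : ∀ i j : Fin (2 * n + 1), N i j = if (i : ℕ) = (j : ℕ) + 1 then 1 else 0)
    (hEdef : ∀ i j : Fin (2 * n + 1), E i j =
      if ((i : ℕ) = 0 ∧ (j : ℕ) = 2 * n - 1) ∨ ((i : ℕ) = 1 ∧ (j : ℕ) = 2 * n)
      then 1 else 0)
    (v : ℤ → Fin (2 * n + 1) → ℂ)
    (hv : ∀ k : ℤ, (k : ℂ) • v k + N.mulVec (v k) + E.mulVec (v (k - 1)) = 0)
    (hfin : ∃ K : ℤ, ∀ k : ℤ, K ≤ k → v k = 0) :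
    ∀ k : ℤ, v k = 0 := by
  have hN : ∀ (w : Fin (2 * n + 1) → ℂ) (i j : Fin (2 * n + 1)), (i : ℕ) = (j : ℕ) + 1 →
      N.mulVec w i = w j := by
    intro w i j hij
    simp only [Matrix.mulVec, dotProduct, hNdef]
    rw [Finset.sum_eq_single j]
    · simp [hij]
    · intro b _ hb
      have : ¬ ((i : ℕ) = (b : ℕ) + 1) := fun h => hb (Fin.ext (by omega))
      simp [this]
    · simp
  have hN0 : ∀ (w : Fin (2 * n + 1) → ℂ) (i : Fin (2 * n + 1)), (i : ℕ) = 0 →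
      N.mulVec w i = 0 := by
    intro w i hi
    simp only [Matrix.mulVec, dotProduct, hNdef]
    refine Finset.sum_eq_zero fun b _ => ?_
    have : ¬ ((i : ℕ) = (b : ℕ) + 1) := by omega
    simp [this]
  have hE : ∀ (w : Fin (2 * n + 1) → ℂ) (i j : Fin (2 * n + 1)),
      (((i : ℕ) = 0 ∧ (j : ℕ) = 2 * n - 1) ∨ ((i : ℕ) = 1 ∧ (j : ℕ) = 2 * n)) →
      E.mulVec w i = w j := by
    intro w i j hij
    simp only [Matrix.mulVec, dotProduct, hEdef]
    rw [Finset.sum_eq_single j]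
    · rw [if_pos hij, one_mul]
    · intro b _ hb
      have hb' : (b : ℕ) ≠ j := fun h => hb (Fin.ext h)
      rw [if_neg (by omega), zero_mul]
    · simp
  have hE0 : ∀ (w : Fin (2 * n + 1) → ℂ) (i : Fin (2 * n + 1)), 2 ≤ (i : ℕ) →
      E.mulVec w i = 0 := by
    intro w i hi
    simp only [Matrix.mulVec, dotProduct, hEdef]
    refine Finset.sum_eq_zero fun b _ => ?_
    rw [if_neg (by omega), zero_mul]
  have hc : ∀ (k : ℤ) (i : Fin (2 * n + 1)),
      (k : ℂ) * v k i + N.mulVec (v k) i + E.mulVec (v (k - 1)) i = 0 := by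
    intro k i
    simpa using congrFun (hv k) i
  let i0 : Fin (2 * n + 1) := ⟨0, by omega⟩
  let i1 : Fin (2 * n + 1) := ⟨1, by omega⟩
  let p : Fin (2 * n + 1) := ⟨2 * n - 1, by omega⟩
  let q : Fin (2 * n + 1) := ⟨2 * n, by omega⟩
  have e0 : ∀ k : ℤ, (k : ℂ) * v k i0 + v (k - 1) p = 0 := by
    intro k
    have h := hc k i0
    rw [hN0 _ i0 rfl, hE _ i0 p (Or.inl ⟨rfl, rfl⟩), add_zero] at h
    exact h
  have e1 : ∀ k : ℤ, (k : ℂ) * v k i1 + v k i0 + v (k - 1) q = 0 := by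
    intro k
    have h := hc k i1
    rw [hN _ i1 i0 rfl, hE _ i1 q (Or.inr ⟨rfl, rfl⟩)] at h
    exact h
  have e2 : ∀ (k : ℤ) (i j : Fin (2 * n + 1)), 2 ≤ (i : ℕ) → (i : ℕ) = (j : ℕ) + 1 →
      (k : ℂ) * v k i + v k j = 0 := by
    intro k i j hi hij
    have h := hc k i
    rw [hN _ i j hij, hE0 _ i hi, add_zero] at h
    exact h
  have step : ∀ k : ℤ, v (k + 1) = 0 → v k = 0 := by
    intro k hk
    have hq : v k q = 0 := by
      have h := e1 (k + 1)
      simpa [hk] using h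
    have down : ∀ d : ℕ, ∀ i : Fin (2 * n + 1), 1 ≤ (i : ℕ) → (i : ℕ) + d = 2 * n →
        v k i = 0 := by
      intro d
      induction d with
      | zero =>
        intro i _ hi
        have : i = q := Fin.ext (by simpa using hi)
        rw [this, hq]
      | succ d ih =>
        intro i h1 hi
        have hlt : (i : ℕ) + 1 < 2 * n + 1 := by omega
        have h := ih ⟨(i : ℕ) + 1, hlt⟩ (by simp) (by simp only; omega)
        have h2 := e2 k ⟨(i : ℕ) + 1, hlt⟩ i (by simp only; omega) rfl
        simpa [h] using h2
    have hi1 : v k i1 = 0 := down (2 * n - 1) i1 le_rfl (by simp only [i1]; omega)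
    have hi0 : v k i0 = 0 := by
      have h0 := e0 k
      have h1 := e1 k
      have h2 := e2 (k - 1) q p (by simp only [q]; omega) (by simp only [p, q]; omega)
      rw [hi1] at h1
      push_cast at h2
      have h3 : (2 * (k : ℂ) - 1) * v k i0 = 0 := by
        linear_combination h0 - h2 + ((k : ℂ) - 1) * h1
      rcases mul_eq_zero.mp h3 with h | h
      · exfalso
        have : ((2 * k - 1 : ℤ) : ℂ) = 0 := by push_cast; exact h
        have := Int.cast_eq_zero.mp this
        omega
      · exact h
    funext i
    by_cases hi : (i : ℕ) = 0
    · have : i = i0 := Fin.ext hi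
      rw [this, hi0]; rfl
    · exact down (2 * n - i) i (by omega) (by omega)
  obtain ⟨K, hK⟩ := hfin
  have all : ∀ d : ℕ, v (K - d) = 0 := by
    intro d
    induction d with
    | zero => exact hK _ (by simp)
    | succ d ih =>
      apply step
      have : K - ((d + 1 : ℕ) : ℤ) + 1 = K - d := by push_cast; ring
      rw [this, ih]
  intro k
  by_cases h : K ≤ k
  · exact hK k h
  · have h2 := all (K - k).toNat
    have : K - ((K - k).toNat : ℤ) = k := by omega
    rwa [this] at h2
end

section
/- A function v : ℤ → ℂ^{2n+1} satisfies N·v(k) + E·v(k−1) = 0 for every k ∈ ℤ if and only if there exists a function c : ℤ → ℂ such that v(k) = c(k)·e_1 − c(k+1)·e_{2n+1} for every k ∈ ℤ, where e_1 and e_{2n+1} are the first and last standard basis vectors. (That is, the kernel of the operator p₁ = N + E t on ℂ^{2n+1}[[t,t^{−1}]] is spanned by the elements e_1 t^k − e_{2n+1} t^{k−1}, k ∈ ℤ.) -/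
/-- For the standard representation of SO_{2n+1}, the kernel of the operator
p₁ = N + E t on doubly-infinite formal series ℂ^{2n+1}[[t,t⁻¹]] is spanned by the
elements e₁ t^k − e_{2n+1} t^{k−1}, k ∈ ℤ: a sequence v lies in the kernel iff
v(k) = c(k)·e₁ − c(k+1)·e_{2n+1} for some scalar sequence c. -/
theorem stmt_8 (n : ℕ) (hn : 1 ≤ n)
    (N E : Matrix (Fin (2 * n + 1)) (Fin (2 * n + 1)) ℂ)
    (hNdef : ∀ i j : Fin (2 * n + 1), N i j = if (i : ℕ) = (j : ℕ) + 1 then 1 else 0)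
    (hEdef : ∀ i j : Fin (2 * n + 1), E i j =
      if ((i : ℕ) = 0 ∧ (j : ℕ) = 2 * n - 1) ∨ ((i : ℕ) = 1 ∧ (j : ℕ) = 2 * n)
      then 1 else 0)
    (v : ℤ → Fin (2 * n + 1) → ℂ) :
    (∀ k : ℤ, N.mulVec (v k) + E.mulVec (v (k - 1)) = 0) ↔
      ∃ c : ℤ → ℂ, ∀ k : ℤ,
        v k = c k • (Pi.single (0 : Fin (2 * n + 1)) (1 : ℂ) : Fin (2 * n + 1) → ℂ)
          - c (k + 1) • (Pi.single (Fin.last (2 * n)) (1 : ℂ) : Fin (2 * n + 1) → ℂ) := by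
  have hN : ∀ (w : Fin (2 * n + 1) → ℂ) (i j : Fin (2 * n + 1)), (i : ℕ) = (j : ℕ) + 1 →
      N.mulVec w i = w j := by
    intro w i j hij
    simp only [Matrix.mulVec, dotProduct]
    rw [Finset.sum_eq_single j]
    · simp [hNdef, hij]
    · intro b _ hb
      have : ¬ ((i : ℕ) = (b : ℕ) + 1) := fun h => hb (Fin.ext (by omega))
      simp [hNdef, this]
    · simp
  have hN0 : ∀ (w : Fin (2 * n + 1) → ℂ), N.mulVec w 0 = 0 := by
    intro w
    simp [Matrix.mulVec, dotProduct, hNdef]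
  have hE : ∀ (w : Fin (2 * n + 1) → ℂ) (i j : Fin (2 * n + 1)),
      (((i : ℕ) = 0 ∧ (j : ℕ) = 2 * n - 1) ∨ ((i : ℕ) = 1 ∧ (j : ℕ) = 2 * n)) →
      E.mulVec w i = w j := by
    intro w i j hij
    simp only [Matrix.mulVec, dotProduct]
    rw [Finset.sum_eq_single j]
    · rw [hEdef, if_pos hij, one_mul]
    · intro b _ hb
      rw [hEdef, if_neg, zero_mul]
      intro h
      exact hb (Fin.ext (by omega))
    · simp
  have hE0 : ∀ (w : Fin (2 * n + 1) → ℂ) (i : Fin (2 * n + 1)), 2 ≤ (i : ℕ) →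
      E.mulVec w i = 0 := by
    intro w i hi
    simp only [Matrix.mulVec, dotProduct]
    refine Finset.sum_eq_zero fun b _ => ?_
    rw [hEdef, if_neg (by omega), zero_mul]
  have hl : (0 : Fin (2 * n + 1)) ≠ Fin.last (2 * n) := by
    intro h
    have := congrArg Fin.val h
    simp at this
    omega
  constructor
  · intro h
    refine ⟨fun k => v k 0, fun k => ?_⟩
    funext j
    by_cases h0 : j = 0
    · subst h0
      simp [hl]
    by_cases h1 : j = Fin.last (2 * n)
    · subst h1
      have := congrFun (h (k + 1)) ⟨1, by omega⟩
      rw [Pi.add_apply, hN _ _ 0 (by simp), hE _ _ (Fin.last (2 * n)) (by simp),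
        add_sub_cancel_right] at this
      simp only [Pi.zero_apply] at this
      simp [hl.symm]
      linear_combination this
    · have hj : (j : ℕ) < 2 * n := by
        have := j.2
        have : (j : ℕ) ≠ 2 * n := fun h => h1 (Fin.ext (by simpa using h))
        omega
      have hj0 : (j : ℕ) ≠ 0 := fun h => h0 (Fin.ext (by simpa using h))
      have := congrFun (h k) ⟨j + 1, by omega⟩
      rw [Pi.add_apply, hN _ _ j rfl, hE0 _ _ (by simp; omega)] at this
      simp only [Pi.zero_apply, add_zero] at this
      simp [h0, h1, this]
  · rintro ⟨c, hc⟩ k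
    funext i
    rw [Pi.add_apply, Pi.zero_apply]
    have hmid : ∀ (k : ℤ) (j : Fin (2 * n + 1)), (j : ℕ) ≠ 0 → (j : ℕ) ≠ 2 * n → v k j = 0 := by
      intro k j h0 h1
      have h0' : j ≠ 0 := fun h => h0 (by simp [h])
      have h1' : j ≠ Fin.last (2 * n) := fun h => h1 (by simp [h])
      simp [hc, h0', h1']
    rcases Nat.lt_or_ge (i : ℕ) 2 with hi | hi
    · rcases Nat.lt_or_ge (i : ℕ) 1 with hi' | hi'
      · have : i = 0 := Fin.ext (by rw [Fin.val_zero]; omega)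
        subst this
        rw [hN0, hE _ _ ⟨2 * n - 1, by omega⟩ (by simp), hmid _ _ (by simp; omega) (by simp; omega),
          add_zero]
      · rw [hN _ i 0 (by simp; omega), hE _ i (Fin.last (2 * n)) (by right; simp; omega),
          hc, hc]
        simp [hl, hl.symm]
    · rw [hE0 _ _ hi, hN _ i ⟨i - 1, by omega⟩ (by simp; omega),
        hmid _ _ (by simp; omega) (by simp; omega), add_zero]
end

section
/- The map sending a solution v : ℤ → ℂ^n of the matrix recursion k·v(k) + N·v(k) + E·v(k−1) = 0 to the scalar sequence g : ℤ → ℂ, g(k) = (v(k))_n (the last coordinate of v(k)), is a linear isomorphism from the space of such solutions onto the space of sequences g : ℤ → ℂ satisfying k^n·g(k) + (−1)^{n+1}·g(k−1) = 0 for all k ∈ ℤ; the inverse is given by (v(k))_i = (−k)^{n−i}·g(k) for 1 ≤ i ≤ n. (This expresses that the connection corresponds to the scalar differential operator (t d/dt)^n + (−1)^{n+1} t.) -/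
/-- Rows of the matrix recursion: the first row, and the row of index `j + 1`. -/
theorem rows_iff (m : ℕ) (N E : Matrix (Fin (m + 1)) (Fin (m + 1)) ℂ)
    (hN : ∀ i j : Fin (m + 1), N i j = if (i : ℕ) = (j : ℕ) + 1 then 1 else 0)
    (hE : ∀ i j : Fin (m + 1), E i j = if (i : ℕ) = 0 ∧ (j : ℕ) = m then 1 else 0)
    (c : ℂ) (x y : Fin (m + 1) → ℂ) :
    c • x + N.mulVec x + E.mulVec y = 0 ↔
      (c * x 0 + y (Fin.last m) = 0 ∧ ∀ j : Fin m, c * x j.succ + x j.castSucc = 0) := by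
  have hN0 : N.mulVec x 0 = 0 := by
    simp [Matrix.mulVec, dotProduct, hN]
  have hNs : ∀ j : Fin m, N.mulVec x j.succ = x j.castSucc := by
    intro j
    simp only [Matrix.mulVec, dotProduct, hN]
    rw [Finset.sum_eq_single j.castSucc]
    · simp
    · intro b _ hb
      have : ¬ ((j.succ : Fin (m + 1)) : ℕ) = (b : ℕ) + 1 := by
        intro h
        apply hb
        ext
        simp at h
        simp [h]
      simp only [if_neg this, zero_mul]
    · simp
  have hE0 : E.mulVec y 0 = y (Fin.last m) := by
    simp only [Matrix.mulVec, dotProduct, hE]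
    rw [Finset.sum_eq_single (Fin.last m)]
    · simp
    · intro b _ hb
      have : ¬ (((0 : Fin (m + 1)) : ℕ) = 0 ∧ (b : ℕ) = m) := by
        rintro ⟨_, h⟩
        apply hb
        ext
        simp [h]
      simp only [if_neg this, zero_mul]
    · simp
  have hEs : ∀ j : Fin m, E.mulVec y j.succ = 0 := by
    intro j
    simp [Matrix.mulVec, dotProduct, hE]
  rw [funext_iff, Fin.forall_fin_succ]
  simp [hN0, hNs, hE0, hEs]

/-- For the standard representation of SL_n, taking the last coordinate
g(k) = (v(k))ₙ is a linear isomorphism from the space of solutions of the matrix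
recursion k·v(k) + N·v(k) + E·v(k−1) = 0 onto the space of scalar sequences
satisfying k^n·g(k) + (−1)^{n+1}·g(k−1) = 0, with inverse
(v(k))ᵢ = (−k)^{n−i}·g(k).  (This expresses that the Frenkel–Gross connection
corresponds to the scalar operator (t d/dt)^n + (−1)^{n+1} t.) -/
theorem stmt_9 (n : ℕ) (hn : 2 ≤ n)
    (N E : Matrix (Fin n) (Fin n) ℂ)
    (hNdef : ∀ i j : Fin n, N i j = if (i : ℕ) = (j : ℕ) + 1 then 1 else 0)
    (hEdef : ∀ i j : Fin n, E i j = if (i : ℕ) = 0 ∧ (j : ℕ) = n - 1 then 1 else 0) :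
    (∀ v : ℤ → Fin n → ℂ,
      (∀ k : ℤ, (k : ℂ) • v k + N.mulVec (v k) + E.mulVec (v (k - 1)) = 0) →
        (∀ k : ℤ, (k : ℂ) ^ n * v k ⟨n - 1, by omega⟩
            + (-1 : ℂ) ^ (n + 1) * v (k - 1) ⟨n - 1, by omega⟩ = 0)
        ∧ ∀ (k : ℤ) (i : Fin n),
            v k i = (-(k : ℂ)) ^ (n - 1 - (i : ℕ)) * v k ⟨n - 1, by omega⟩)
    ∧ ∀ g : ℤ → ℂ,
        (∀ k : ℤ, (k : ℂ) ^ n * g k + (-1 : ℂ) ^ (n + 1) * g (k - 1) = 0) →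
        ∀ v : ℤ → Fin n → ℂ,
          (∀ (k : ℤ) (i : Fin n), v k i = (-(k : ℂ)) ^ (n - 1 - (i : ℕ)) * g k) →
          ∀ k : ℤ, (k : ℂ) • v k + N.mulVec (v k) + E.mulVec (v (k - 1)) = 0 := by
  obtain ⟨m, rfl⟩ : ∃ m, n = m + 1 := ⟨n - 1, by omega⟩
  have key := rows_iff m N E hNdef hEdef
  have hlast : (⟨m, by omega⟩ : Fin (m + 1)) = Fin.last m := rfl
  have hsq : (-1 : ℂ) ^ m * (-1 : ℂ) ^ m = 1 := by
    rw [← mul_pow]; simp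
  simp only [key, Nat.add_sub_cancel, hlast]
  constructor
  · intro v hv
    have h2 : ∀ (k : ℤ) (i : Fin (m + 1)),
        v k i = (-(k : ℂ)) ^ (m - (i : ℕ)) * v k (Fin.last m) := by
      intro k i
      induction i using Fin.reverseInduction with
      | last => simp
      | cast j ih =>
        have h := (hv k).2 j
        have e : m - (j.castSucc : ℕ) = (m - (j.succ : ℕ)) + 1 := by
          have := j.isLt
          simp only [Fin.val_castSucc, Fin.val_succ]
          omega
        rw [e, pow_succ]
        linear_combination h - (k : ℂ) * ih
    refine ⟨fun k => ?_, h2⟩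
    have h := (hv k).1
    have h0 := h2 k 0
    simp only [Fin.val_zero, Nat.sub_zero] at h0
    rw [h0, neg_pow] at h
    linear_combination (-1 : ℂ) ^ m * h - (k : ℂ) ^ (m + 1) * v k (Fin.last m) * hsq
  · intro g hg v hv k
    constructor
    · have h := hg k
      rw [hv, hv]
      simp only [Fin.val_zero, Nat.sub_zero, Fin.val_last, Nat.sub_self, pow_zero, one_mul]
      rw [neg_pow]
      linear_combination (-1 : ℂ) ^ m * h - g (k - 1) * hsq
    · intro j
      have e : m - (j.castSucc : ℕ) = (m - (j.succ : ℕ)) + 1 := by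
        have := j.isLt
        simp only [Fin.val_castSucc, Fin.val_succ]
        omega
      rw [hv, hv, e, pow_succ]
      ring
end

section
/- The map sending a solution v : ℤ → ℂ^{2n+1} of the matrix recursion k·v(k) + N·v(k) + E·v(k−1) = 0 to the scalar sequence g : ℤ → ℂ, g(k) = (v(k))_{2n+1} (the last coordinate of v(k)), is a linear isomorphism from the space of such solutions onto the space of sequences g : ℤ → ℂ satisfying k^{2n+1}·g(k) = (2k−1)·g(k−1) for all k ∈ ℤ; the inverse is given by (v(k))_i = (−k)^{2n+1−i}·g(k) for 2 ≤ i ≤ 2n+1 and (v(k))_1 = k^{2n}·g(k) − g(k−1). (This expresses that the connection corresponds to the scalar differential operator (t d/dt)^{2n+1} − 2t² d/dt − t.) -/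
/-- For the standard representation of SO_{2n+1}, taking the last coordinate
g(k) = (v(k))_{2n+1} is a linear isomorphism from the space of solutions of the
matrix recursion k·v(k) + N·v(k) + E·v(k−1) = 0 onto the space of scalar
sequences satisfying k^{2n+1}·g(k) = (2k−1)·g(k−1), with inverse
(v(k))ᵢ = (−k)^{2n+1−i}·g(k) for 2 ≤ i ≤ 2n+1 and
(v(k))₁ = k^{2n}·g(k) − g(k−1).  (This expresses that the Frenkel–Gross
connection corresponds to the scalar operator (t d/dt)^{2n+1} − 2t² d/dt − t.) -/
theorem stmt_10 (n : ℕ) (hn : 1 ≤ n)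
    (N E : Matrix (Fin (2 * n + 1)) (Fin (2 * n + 1)) ℂ)
    (hNdef : ∀ i j : Fin (2 * n + 1), N i j = if (i : ℕ) = (j : ℕ) + 1 then 1 else 0)
    (hEdef : ∀ i j : Fin (2 * n + 1), E i j =
      if ((i : ℕ) = 0 ∧ (j : ℕ) = 2 * n - 1) ∨ ((i : ℕ) = 1 ∧ (j : ℕ) = 2 * n)
      then 1 else 0) :
    (∀ v : ℤ → Fin (2 * n + 1) → ℂ,
      (∀ k : ℤ, (k : ℂ) • v k + N.mulVec (v k) + E.mulVec (v (k - 1)) = 0) →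
        (∀ k : ℤ, (k : ℂ) ^ (2 * n + 1) * v k (Fin.last (2 * n))
            = (2 * (k : ℂ) - 1) * v (k - 1) (Fin.last (2 * n)))
        ∧ (∀ (k : ℤ) (i : Fin (2 * n + 1)), 1 ≤ (i : ℕ) →
            v k i = (-(k : ℂ)) ^ (2 * n - (i : ℕ)) * v k (Fin.last (2 * n)))
        ∧ ∀ k : ℤ, v k 0 = (k : ℂ) ^ (2 * n) * v k (Fin.last (2 * n))
            - v (k - 1) (Fin.last (2 * n)))
    ∧ ∀ g : ℤ → ℂ,
        (∀ k : ℤ, (k : ℂ) ^ (2 * n + 1) * g k = (2 * (k : ℂ) - 1) * g (k - 1)) →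
        ∀ v : ℤ → Fin (2 * n + 1) → ℂ,
          (∀ (k : ℤ) (i : Fin (2 * n + 1)), 1 ≤ (i : ℕ) →
            v k i = (-(k : ℂ)) ^ (2 * n - (i : ℕ)) * g k) →
          (∀ k : ℤ, v k 0 = (k : ℂ) ^ (2 * n) * g k - g (k - 1)) →
          ∀ k : ℤ, (k : ℂ) • v k + N.mulVec (v k) + E.mulVec (v (k - 1)) = 0 := by
  have hN0 : ∀ w : Fin (2 * n + 1) → ℂ, N.mulVec w 0 = 0 := by
    intro w
    simp only [Matrix.mulVec, dotProduct, hNdef]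
    apply Finset.sum_eq_zero
    intro j _
    simp
  have hNS : ∀ (w : Fin (2 * n + 1) → ℂ) (m : ℕ) (hm : m + 1 < 2 * n + 1),
      N.mulVec w ⟨m + 1, hm⟩ = w ⟨m, by omega⟩ := by
    intro w m hm
    simp only [Matrix.mulVec, dotProduct, hNdef]
    rw [Finset.sum_eq_single (⟨m, by omega⟩ : Fin (2 * n + 1))]
    · simp
    · intro j _ hj
      rw [if_neg, zero_mul]
      intro h
      apply hj
      ext
      simp only at h ⊢
      omega
    · simp
  have hE0 : ∀ w : Fin (2 * n + 1) → ℂ, E.mulVec w 0 = w ⟨2 * n - 1, by omega⟩ := by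
    intro w
    simp only [Matrix.mulVec, dotProduct, hEdef]
    rw [Finset.sum_eq_single (⟨2 * n - 1, by omega⟩ : Fin (2 * n + 1))]
    · simp
    · intro j _ hj
      rw [if_neg, zero_mul]
      intro h
      apply hj
      ext
      simp only [Fin.val_zero] at h ⊢
      omega
    · simp
  have hE1 : ∀ w : Fin (2 * n + 1) → ℂ,
      E.mulVec w ⟨0 + 1, by omega⟩ = w (Fin.last (2 * n)) := by
    intro w
    simp only [Matrix.mulVec, dotProduct, hEdef]
    rw [Finset.sum_eq_single (Fin.last (2 * n))]
    · simp
    · intro j _ hj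
      rw [if_neg, zero_mul]
      intro h
      apply hj
      ext
      simp only [Fin.val_last] at h ⊢
      omega
    · simp
  have hE2 : ∀ (w : Fin (2 * n + 1) → ℂ) (m : ℕ) (hm : m + 1 + 1 < 2 * n + 1),
      E.mulVec w ⟨m + 1 + 1, hm⟩ = 0 := by
    intro w m hm
    simp only [Matrix.mulVec, dotProduct, hEdef]
    apply Finset.sum_eq_zero
    intro j _
    rw [if_neg, zero_mul]
    intro h
    omega
  have hz : (⟨0, by omega⟩ : Fin (2 * n + 1)) = 0 := rfl
  have hsub : 2 * n - (2 * n - 1) = 1 := by omega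
  constructor
  · intro v hv
    have r0 : ∀ k : ℤ, (k : ℂ) * v k 0 + v (k - 1) ⟨2 * n - 1, by omega⟩ = 0 := by
      intro k
      have := congrFun (hv k) 0
      simpa [hN0, hE0] using this
    have r1 : ∀ k : ℤ, (k : ℂ) * v k ⟨0 + 1, by omega⟩ + v k 0
        + v (k - 1) (Fin.last (2 * n)) = 0 := by
      intro k
      have := congrFun (hv k) ⟨0 + 1, by omega⟩
      simp only [Pi.add_apply, Pi.smul_apply, smul_eq_mul, Pi.zero_apply, hNS, hE1] at this
      exact this
    have r2 : ∀ (k : ℤ) (m : ℕ) (hm : m + 1 + 1 < 2 * n + 1),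
        (k : ℂ) * v k ⟨m + 1 + 1, hm⟩ + v k ⟨m + 1, by omega⟩ = 0 := by
      intro k m hm
      have := congrFun (hv k) ⟨m + 1 + 1, hm⟩
      simp only [Pi.add_apply, Pi.smul_apply, smul_eq_mul, Pi.zero_apply, hNS, hE2,
        add_zero] at this
      exact this
    have key : ∀ (k : ℤ) (d m : ℕ) (hd : m + 1 + d = 2 * n),
        v k ⟨m + 1, by omega⟩ = (-(k : ℂ)) ^ d * v k (Fin.last (2 * n)) := by
      intro k d
      induction d with
      | zero =>
        intro m hd
        have : (⟨m + 1, by omega⟩ : Fin (2 * n + 1)) = Fin.last (2 * n) := by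
          ext
          simpa using hd
        rw [this]
        simp
      | succ d ih =>
        intro m hd
        have h1 := ih (m + 1) (by omega)
        have h2 := r2 k m (by omega)
        rw [h1] at h2
        rw [pow_succ]
        linear_combination h2
    have hi : ∀ (k : ℤ) (i : Fin (2 * n + 1)), 1 ≤ (i : ℕ) →
            v k i = (-(k : ℂ)) ^ (2 * n - (i : ℕ)) * v k (Fin.last (2 * n)) := by
      intro k i h
      obtain ⟨i, hi⟩ := i
      obtain ⟨m, rfl⟩ : ∃ m, i = m + 1 := ⟨i - 1, by simp only at h; omega⟩
      exact key k _ m (by simp only; omega)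
    have h0 : ∀ k : ℤ, v k 0 = (k : ℂ) ^ (2 * n) * v k (Fin.last (2 * n))
            - v (k - 1) (Fin.last (2 * n)) := by
      intro k
      have h1 := r1 k
      rw [key k (2 * n - 1) 0 (by omega)] at h1
      have h2 : (k : ℂ) ^ (2 * n) = (-(k : ℂ)) ^ (2 * n - 1) * (-(k : ℂ)) := by
        rw [← pow_succ, Nat.sub_add_cancel (by omega), Even.neg_pow (by simp)]
      rw [h2]
      linear_combination h1
    refine ⟨fun k => ?_, hi, h0⟩
    have h1 := r0 k
    rw [h0 k, hi (k - 1) ⟨2 * n - 1, by omega⟩ (by simp only; omega)] at h1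
    simp only [hsub] at h1
    push_cast at h1
    rw [pow_succ]
    linear_combination h1
  · intro g hg v hv hv0 k
    have hl : ∀ k : ℤ, v k (Fin.last (2 * n)) = g k := by
      intro k
      rw [hv k _ (by simp only [Fin.val_last]; omega)]
      simp
    ext i
    obtain ⟨i, hi⟩ := i
    simp only [Pi.add_apply, Pi.smul_apply, smul_eq_mul, Pi.zero_apply]
    rcases i with _ | _ | m
    · rw [hz, hN0, hE0, hv0, hv (k - 1) ⟨2 * n - 1, by omega⟩ (by simp only; omega)]
      simp only [hsub]
      push_cast
      have := hg k
      rw [pow_succ] at this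
      linear_combination this
    · rw [hNS, hE1, hl, hz, hv0, hv k _ (by simp)]
      have h2 : (k : ℂ) ^ (2 * n) = (-(k : ℂ)) ^ (2 * n - 1) * (-(k : ℂ)) := by
        rw [← pow_succ, Nat.sub_add_cancel (by omega), Even.neg_pow (by simp)]
      rw [h2]
      simp only [zero_add]
      ring
    · rw [hNS, hE2, hv k _ (by simp), hv k _ (by simp)]
      have h3 : 2 * n - (m + 1) = 2 * n - (m + 1 + 1) + 1 := by omega
      simp only [h3, pow_succ]
      ring
end

section
/- The characteristic polynomial of the (2n+1)×(2n+1) matrix N + E equals X^{2n+1} − 2X; consequently N + E is diagonalizable with 2n+1 distinct eigenvalues, namely 0 together with the 2n complex roots of X^{2n} = 2. (This is the instance, for the standard representation of SO_{2n+1}, of Kostant's theorem that N + E is regular semisimple, which underlies the fact that the Frenkel–Gross connection has slope 1/h at infinity, h = 2n being the Coxeter number.) -/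
theorem charpoly_conj_aux {m : ℕ} (P A : Matrix (Fin m) (Fin m) ℂ) (hP : IsUnit P) :
    (P * A * P⁻¹).charpoly = A.charpoly := by
  obtain ⟨u, rfl⟩ := hP
  exact Matrix.charpoly_units_conj u A

open Polynomial in
theorem exists_roots (n : ℕ) (hn : 1 ≤ n) :
    ∃ D : Fin (2 * n + 1) → ℂ, Function.Injective D
      ∧ Set.range D = {x : ℂ | x = 0 ∨ x ^ (2 * n) = 2}
      ∧ ∏ i, (X - C (D i)) = (X ^ (2 * n + 1) - 2 * X : ℂ[X]) := by
  set p : ℂ[X] := X ^ (2 * n + 1) - 2 * X with hp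
  have hfac : p = X * (X ^ (2 * n) - C 2) := by
    rw [hp, show (C (2 : ℂ) : ℂ[X]) = 2 from rfl]; ring
  have h2n : ((2 * n : ℕ) : ℂ) ≠ 0 := by
    exact_mod_cast (by omega : 2 * n ≠ 0)
  have hsep : p.Separable := by
    rw [hfac]
    refine Separable.mul separable_X (separable_X_pow_sub_C (2 : ℂ) h2n two_ne_zero) ?_
    refine ⟨X ^ (2 * n - 1) * C (1 / 2), - C (1 / 2), ?_⟩
    have e : (X : ℂ[X]) ^ (2 * n) = X ^ (2 * n - 1) * X := by
      rw [← pow_succ]; congr 1; omega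
    have h1 : (C (1 / 2) * C 2 : ℂ[X]) = 1 := by
      rw [← C_mul]; norm_num
    rw [e]
    linear_combination h1
  have hm2 : (X ^ (2 * n) - C (2 : ℂ)).Monic := monic_X_pow_sub_C _ (by omega)
  have hm : p.Monic := by
    rw [hfac]
    exact monic_X.mul hm2
  have hdeg : p.natDegree = 2 * n + 1 := by
    rw [hfac, monic_X.natDegree_mul hm2, natDegree_X, natDegree_X_pow_sub_C]; ring
  have hsplit : p.roots.card = p.natDegree :=
    (splits_iff_card_roots).1 (IsAlgClosed.splits p)
  have hnod : p.roots.Nodup := nodup_roots hsep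
  have hcard : p.roots.toFinset.card = 2 * n + 1 := by
    rw [Multiset.toFinset_card_of_nodup hnod, hsplit, hdeg]
  let e := (Finset.equivFinOfCardEq hcard).symm
  refine ⟨fun i => (e i : ℂ), Subtype.val_injective.comp e.injective, ?_, ?_⟩
  · have : Set.range (fun i => (e i : ℂ)) = (p.roots.toFinset : Set ℂ) := by
      ext x
      constructor
      · rintro ⟨i, rfl⟩
        exact (e i).2
      · intro hx
        exact ⟨e.symm ⟨x, hx⟩, by simp⟩
    rw [this]
    ext x
    simp only [Finset.mem_coe, Multiset.mem_toFinset, mem_roots hm.ne_zero, Set.mem_ofPred_eq]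
    rw [hfac]
    simp [IsRoot, sub_eq_zero]
  · have h1 : ∏ i, (X - C (e i : ℂ)) = ∏ a : p.roots.toFinset, (X - C (a : ℂ)) :=
      Equiv.prod_comp e (fun a => X - C (a : ℂ))
    rw [h1, Finset.prod_coe_sort p.roots.toFinset (fun a => X - C a)]
    have h2 := prod_multiset_X_sub_C_of_monic_of_roots_card_eq hm hsplit
    rw [Finset.prod, Multiset.toFinset_val, hnod.dedup]
    exact h2

/-- Kostant's theorem in the standard representation of SO_{2n+1}: the
characteristic polynomial of N + E is X^{2n+1} − 2X, so N + E is diagonalizable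
with 2n+1 distinct eigenvalues, namely 0 together with the 2n complex roots of
X^{2n} = 2. -/
theorem stmt_12 (n : ℕ) (hn : 1 ≤ n)
    (N E : Matrix (Fin (2 * n + 1)) (Fin (2 * n + 1)) ℂ)
    (hNdef : ∀ i j : Fin (2 * n + 1), N i j = if (i : ℕ) = (j : ℕ) + 1 then 1 else 0)
    (hEdef : ∀ i j : Fin (2 * n + 1), E i j =
      if ((i : ℕ) = 0 ∧ (j : ℕ) = 2 * n - 1) ∨ ((i : ℕ) = 1 ∧ (j : ℕ) = 2 * n)
      then 1 else 0) :
    (N + E).charpoly = Polynomial.X ^ (2 * n + 1) - 2 * Polynomial.X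
    ∧ ∃ (P : Matrix (Fin (2 * n + 1)) (Fin (2 * n + 1)) ℂ) (D : Fin (2 * n + 1) → ℂ),
        IsUnit P.det ∧ Function.Injective D
        ∧ Set.range D = {x : ℂ | x = 0 ∨ x ^ (2 * n) = 2}
        ∧ N + E = P * Matrix.diagonal D * P⁻¹ := by
  obtain ⟨D, hinj, hrange, hprod⟩ := exists_roots n hn
  have hD : ∀ j, D j * D j ^ (2 * n) = 2 * D j := by
    intro j
    have : D j ∈ {x : ℂ | x = 0 ∨ x ^ (2 * n) = 2} := hrange ▸ ⟨j, rfl⟩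
    rcases this with h | h
    · simp [h]
    · rw [h]; ring
  let w : ℕ → ℂ → ℂ := fun i x => x ^ (2 * n - i) - if i = 0 then 1 else 0
  let P : Matrix (Fin (2 * n + 1)) (Fin (2 * n + 1)) ℂ := fun i j => w i (D j)
  have key : ∀ (v : ℕ → ℂ) (i : Fin (2 * n + 1)),
      ∑ k : Fin (2 * n + 1), (N + E) i k * v k =
        if (i : ℕ) = 0 then v (2 * n - 1) else
          if (i : ℕ) = 1 then v 0 + v (2 * n) else v (i - 1) := by
    intro v i
    simp only [Matrix.add_apply, hNdef, hEdef]
    rw [Fin.sum_univ_eq_sum_range (fun k => ((if (i : ℕ) = k + 1 then (1 : ℂ) else 0) +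
      if ((i : ℕ) = 0 ∧ k = 2 * n - 1) ∨ ((i : ℕ) = 1 ∧ k = 2 * n) then 1 else 0) * v k)]
    have hi := i.2
    simp only [add_mul, Finset.sum_add_distrib, ite_mul, one_mul, zero_mul]
    split_ifs with h0 h1
    · simp [h0]
    · have : ∀ k, (1 = k + 1) ↔ k = 0 := by intro k; omega
      simp [h1, this]
    · have : ∀ k, ((i : ℕ) = k + 1) ↔ k = i - 1 := by intro k; omega
      simp [h0, h1, this]
      try (intro h; omega)
  have hMP : (N + E) * P = P * Matrix.diagonal D := by
    ext i j
    rw [Matrix.mul_apply, Matrix.mul_diagonal]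
    rw [key (fun k => w k (D j)) i]
    have hi := i.2
    simp only [P, w]
    have hd := hD j
    have e0 : 2 * n - 1 ≠ 0 := by omega
    have e1 : 2 * n - (2 * n - 1) = 1 := by omega
    have e2 : 2 * n ≠ 0 := by omega
    by_cases h0 : (i : ℕ) = 0
    · rw [h0, if_pos rfl, if_neg e0, if_pos rfl, e1, Nat.sub_zero]
      linear_combination -hd
    by_cases h1 : (i : ℕ) = 1
    · rw [h1, if_neg one_ne_zero, if_pos rfl, if_pos trivial, if_neg e2, if_neg one_ne_zero,
        Nat.sub_self, Nat.sub_zero, sub_zero, sub_zero, ← pow_succ, Nat.sub_add_cancel (by omega)]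
      ring
    · rw [if_neg h0, if_neg h1, if_neg (by omega), if_neg h0, sub_zero, sub_zero, ← pow_succ]
      congr 1
      omega
  have hcol : ∀ j, (N + E).mulVec (P.col j) = D j • P.col j := by
    intro j
    ext i
    have := congrFun (congrFun hMP i) j
    rw [Matrix.mul_apply, Matrix.mul_diagonal] at this
    simpa [Matrix.mulVec, dotProduct, mul_comm] using this
  have hlast : ∀ j, P (Fin.last _) j = 1 := by
    intro j
    have : n ≠ 0 := by omega
    simp [P, w, this]
  have hli : LinearIndependent ℂ P.col := by
    refine Module.End.eigenvectors_linearIndependent' (Matrix.toLin' (N + E)) D hinj P.col ?_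
    intro j
    rw [Module.End.hasEigenvector_iff, Module.End.mem_eigenspace_iff]
    refine ⟨by rw [Matrix.toLin'_apply]; exact hcol j, fun h => ?_⟩
    have h1 := congrFun h (Fin.last _)
    have h2 := hlast j
    simp only [Matrix.col_apply, Pi.zero_apply] at h1
    rw [h1] at h2
    exact zero_ne_one h2
  have hPu : IsUnit P := Matrix.linearIndependent_cols_iff_isUnit.1 hli
  have hPd : IsUnit P.det := (Matrix.isUnit_iff_isUnit_det P).1 hPu
  have hconj : N + E = P * Matrix.diagonal D * P⁻¹ := by
    rw [← hMP, Matrix.mul_nonsing_inv_cancel_right _ _ hPd]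
  refine ⟨?_, P, D, hPd, hinj, hrange, hconj⟩
  have h3 : (N + E).charpoly = (Matrix.diagonal D).charpoly := by
    rw [hconj]
    exact charpoly_conj_aux P _ hPu
  rw [h3, Matrix.charpoly_diagonal, hprod]
end

section
/- The set of adjoint solutions v : ℤ → sl_n of the recursion k·v(k) + [N, v(k)] + [E, v(k−1)] = 0 is a complex vector space on which the evaluation map v ↦ v(0) is a linear isomorphism onto the centralizer of N in sl_n, i.e. onto {X ∈ sl_n : NX = XN} = span{N, N², …, N^{n−1}}; in particular the space of adjoint solutions has dimension n − 1, the rank of SL_n. -/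
/-- The space of doubly-infinite formal solutions of the adjoint Frenkel–Gross
recursion with values in traceless matrices, as a submodule of
ℤ → Matrix (Fin n) (Fin n) ℂ. -/
noncomputable def adjSolSpace (n : ℕ) (N E : Matrix (Fin n) (Fin n) ℂ) :
    Submodule ℂ (ℤ → Matrix (Fin n) (Fin n) ℂ) :=
  (⨅ k : ℤ, LinearMap.ker
      ((Matrix.traceLinearMap (Fin n) ℂ ℂ).comp
        (LinearMap.proj k : (ℤ → Matrix (Fin n) (Fin n) ℂ) →ₗ[ℂ] Matrix (Fin n) (Fin n) ℂ)))
  ⊓ ⨅ k : ℤ, LinearMap.ker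
      ((k : ℂ) • (LinearMap.proj k : (ℤ → Matrix (Fin n) (Fin n) ℂ) →ₗ[ℂ] Matrix (Fin n) (Fin n) ℂ)
        + (LinearMap.mulLeft ℂ N - LinearMap.mulRight ℂ N).comp (LinearMap.proj k)
        + (LinearMap.mulLeft ℂ E - LinearMap.mulRight ℂ E).comp (LinearMap.proj (k - 1)))

namespace FGAux

lemma dm_pred (n : ℤ) (hn : 0 < n) (a : ℤ) :
    (a % n = 0 → (a - 1) / n = a / n - 1 ∧ (a - 1) % n = n - 1) ∧
    (a % n ≠ 0 → (a - 1) / n = a / n ∧ (a - 1) % n = a % n - 1) := by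
  have h1 := Int.emod_add_mul_ediv a n
  have h2 := Int.emod_nonneg a hn.ne'
  have h3 := Int.emod_lt_of_pos a hn
  constructor
  · intro h
    refine (Int.ediv_emod_unique hn).2 ⟨?_, by omega, by omega⟩
    rw [h] at h1
    linear_combination h1
  · intro h
    refine (Int.ediv_emod_unique hn).2 ⟨?_, by omega, by omega⟩
    linear_combination h1

/-- residue of an integer as an index -/
def res (n : ℕ) (hn : 2 ≤ n) (a : ℤ) : Fin n :=
  ⟨(a % (n : ℤ)).toNat, by
    have h2 := Int.emod_nonneg a (show (n : ℤ) ≠ 0 by omega)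
    have h3 := Int.emod_lt_of_pos a (show (0 : ℤ) < n by omega)
    omega⟩

lemma res_val (n : ℕ) (hn : 2 ≤ n) (a : ℤ) : ((res n hn a : ℕ) : ℤ) = a % (n : ℤ) := by
  have h2 := Int.emod_nonneg a (show (n : ℤ) ≠ 0 by omega)
  simp [res, h2]

lemma res_fin (n : ℕ) (hn : 2 ≤ n) (i : Fin n) : res n hn (i : ℕ) = i := by
  apply Fin.ext
  have := res_val n hn (i : ℕ)
  rw [Int.emod_eq_of_lt (by omega) (by have := i.2; omega)] at this
  exact_mod_cast this

variable {n : ℕ}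

lemma mul_entries (hn : 2 ≤ n) (N E : Matrix (Fin n) (Fin n) ℂ)
    (hNdef : ∀ i j : Fin n, N i j = if (i : ℕ) = (j : ℕ) + 1 then 1 else 0)
    (hEdef : ∀ i j : Fin n, E i j = if (i : ℕ) = 0 ∧ (j : ℕ) = n - 1 then 1 else 0)
    (M : Matrix (Fin n) (Fin n) ℂ) (a : ℤ) (i : Fin n) :
    (N * M) (res n hn a) i = (if a % (n : ℤ) = 0 then 0 else M (res n hn (a - 1)) i) ∧
    (E * M) (res n hn a) i = (if a % (n : ℤ) = 0 then M (res n hn (a - 1)) i else 0) ∧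
    (M * N) i (res n hn (a - 1)) = (if a % (n : ℤ) = 0 then 0 else M i (res n hn a)) ∧
    (M * E) i (res n hn (a - 1)) = (if a % (n : ℤ) = 0 then M i (res n hn a) else 0) := by
  have h0 := dm_pred n (by omega) a
  have ha := res_val n hn a
  have ha1 := res_val n hn (a - 1)
  have h2 := Int.emod_nonneg a (show (n : ℤ) ≠ 0 by omega)
  have h3 := Int.emod_lt_of_pos a (show (0 : ℤ) < n by omega)
  have hf : ∀ i j : Fin n, i = j ↔ ((i : ℕ) : ℤ) = ((j : ℕ) : ℤ) := by
    intro i j; rw [Fin.ext_iff]; omega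
  by_cases h : a % (n : ℤ) = 0
  · obtain ⟨-, h0⟩ := h0.1 h
    have e1 : ∀ j, N (res n hn a) j = 0 := by
      intro j; rw [hNdef, if_neg]; omega
    have e2 : ∀ j, E (res n hn a) j = if j = res n hn (a - 1) then 1 else 0 := by
      intro j; rw [hEdef]; congr 1; rw [hf]; apply propext; omega
    have e3 : ∀ j, N j (res n hn (a - 1)) = 0 := by
      intro j; rw [hNdef, if_neg]; have := j.2; omega
    have e4 : ∀ j, E j (res n hn (a - 1)) = if j = res n hn a then 1 else 0 := by
      intro j; rw [hEdef]; congr 1; rw [hf]; apply propext; omega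
    simp [Matrix.mul_apply, e1, e2, e3, e4, h]
  · obtain ⟨-, h0⟩ := h0.2 h
    have e1 : ∀ j, E (res n hn a) j = 0 := by
      intro j; rw [hEdef, if_neg]; omega
    have e2 : ∀ j, N (res n hn a) j = if j = res n hn (a - 1) then 1 else 0 := by
      intro j; rw [hNdef]; congr 1; rw [hf]; apply propext; omega
    have e3 : ∀ j, E j (res n hn (a - 1)) = 0 := by
      intro j; rw [hEdef, if_neg]; omega
    have e4 : ∀ j, N j (res n hn (a - 1)) = if j = res n hn a then 1 else 0 := by
      intro j; rw [hNdef]; congr 1; rw [hf]; apply propext; omega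
    simp [Matrix.mul_apply, e1, e2, e3, e4, h]

/-- the solution spread out as an infinite periodic matrix -/
def uu (hn : 2 ≤ n) (v : ℤ → Matrix (Fin n) (Fin n) ℂ) (a b : ℤ) : ℂ :=
  v (a / n - b / n) (res n hn a) (res n hn b)

lemma uu_eq (hn : 2 ≤ n) (N E : Matrix (Fin n) (Fin n) ℂ)
    (hNdef : ∀ i j : Fin n, N i j = if (i : ℕ) = (j : ℕ) + 1 then 1 else 0)
    (hEdef : ∀ i j : Fin n, E i j = if (i : ℕ) = 0 ∧ (j : ℕ) = n - 1 then 1 else 0)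
    (v : ℤ → Matrix (Fin n) (Fin n) ℂ)
    (hv : ∀ k : ℤ, (k : ℂ) • v k + (N * v k - v k * N) + (E * v (k - 1) - v (k - 1) * E) = 0)
    (a b : ℤ) :
    ((a / n - (b - 1) / n : ℤ) : ℂ) * uu hn v a (b - 1)
      + (uu hn v (a - 1) (b - 1) - uu hn v a b) = 0 := by
  have h := congrFun (congrFun (hv (a / n - (b - 1) / n)) (res n hn a)) (res n hn (b - 1))
  simp only [Matrix.add_apply, Matrix.sub_apply, Matrix.smul_apply, smul_eq_mul,
    Matrix.zero_apply] at h
  obtain ⟨p1, -, -, -⟩ := mul_entries hn N E hNdef hEdef (v (a / n - (b - 1) / n)) a (res n hn (b - 1))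
  obtain ⟨-, p2, -, -⟩ := mul_entries hn N E hNdef hEdef (v (a / n - (b - 1) / n - 1)) a (res n hn (b - 1))
  obtain ⟨-, -, p3, -⟩ := mul_entries hn N E hNdef hEdef (v (a / n - (b - 1) / n)) b (res n hn a)
  obtain ⟨-, -, -, p4⟩ := mul_entries hn N E hNdef hEdef (v (a / n - (b - 1) / n - 1)) b (res n hn a)
  rw [p1, p2, p3, p4] at h
  have q1 := dm_pred n (by omega) a
  have q2 := dm_pred n (by omega) b
  have r1 : uu hn v (a - 1) (b - 1) = if a % (n : ℤ) = 0 then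
      v (a / n - (b - 1) / n - 1) (res n hn (a - 1)) (res n hn (b - 1)) else
      v (a / n - (b - 1) / n) (res n hn (a - 1)) (res n hn (b - 1)) := by
    unfold uu
    split_ifs with c
    · rw [(q1.1 c).1, sub_right_comm]
    · rw [(q1.2 c).1]
  have r2 : uu hn v a b = if b % (n : ℤ) = 0 then
      v (a / n - (b - 1) / n - 1) (res n hn a) (res n hn b) else
      v (a / n - (b - 1) / n) (res n hn a) (res n hn b) := by
    unfold uu
    split_ifs with c
    · rw [(q2.1 c).1, show a / (n : ℤ) - (b / n - 1) - 1 = a / n - b / n by ring]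
    · rw [(q2.2 c).1]
  rw [r1, r2, show uu hn v a (b - 1) = v (a / n - (b - 1) / n) (res n hn a) (res n hn (b - 1)) from rfl,
    ← h]
  split_ifs <;> ring

lemma uu_periodic (hn : 2 ≤ n) (v : ℤ → Matrix (Fin n) (Fin n) ℂ) (a b : ℤ) :
    uu hn v (a + n) (b + n) = uu hn v a b := by
  have h : (n : ℤ) ≠ 0 := by omega
  have hr : ∀ a : ℤ, res n hn (a + n) = res n hn a := by
    intro a; apply Fin.ext; simp [res]
  unfold uu
  rw [hr, hr, Int.add_ediv_of_dvd_right (dvd_refl _), Int.add_ediv_of_dvd_right (dvd_refl _),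
    add_sub_add_right_eq_sub]

lemma floor_sum (hn : 2 ≤ n) (d : ℤ) :
    ∑ i ∈ Finset.range n, ((i : ℤ) - d) / (n : ℤ) = -d := by
  have h : (n : ℤ) ≠ 0 := by omega
  have step : ∀ d : ℤ, ∑ i ∈ Finset.range n, ((i : ℤ) - d) / (n : ℤ)
      = ∑ i ∈ Finset.range n, ((i : ℤ) - (d + 1)) / (n : ℤ) + 1 := by
    intro d
    have t := Finset.sum_range_sub (fun i : ℕ => ((i : ℤ) - (d + 1)) / (n : ℤ)) n
    rw [Finset.sum_sub_distrib] at t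
    have e : ((n : ℤ) - (d + 1)) / (n : ℤ) = ((0 : ℕ) - (d + 1)) / (n : ℤ) + 1 := by
      rw [show (n : ℤ) - (d + 1) = ((0 : ℕ) - (d + 1)) + n by push_cast; ring,
        Int.add_ediv_of_dvd_right (dvd_refl _), Int.ediv_self h]
    rw [e] at t
    have e2 : ∑ i ∈ Finset.range n, ((i : ℤ) - d) / (n : ℤ)
      = ∑ i ∈ Finset.range n, (((i + 1 : ℕ) : ℤ) - (d + 1)) / (n : ℤ) := by
      apply Finset.sum_congr rfl; intro i _; congr 1; push_cast; ring
    rw [e2]; linarith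
  induction d using Int.induction_on with
  | zero =>
    rw [neg_zero]
    apply Finset.sum_eq_zero
    intro i hi
    have := Finset.mem_range.1 hi
    rw [sub_zero]
    exact Int.ediv_eq_zero_of_lt (by omega) (by omega)
  | succ i ih => have := step i; linarith
  | pred i ih =>
    have := step (-(i : ℤ) - 1)
    rw [show (-(i : ℤ) - 1 + 1) = -i by ring] at this
    linarith

lemma uu_zero (hn : 2 ≤ n) (N E : Matrix (Fin n) (Fin n) ℂ)
    (hNdef : ∀ i j : Fin n, N i j = if (i : ℕ) = (j : ℕ) + 1 then 1 else 0)
    (hEdef : ∀ i j : Fin n, E i j = if (i : ℕ) = 0 ∧ (j : ℕ) = n - 1 then 1 else 0)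
    (v : ℤ → Matrix (Fin n) (Fin n) ℂ)
    (hv : ∀ k : ℤ, (k : ℂ) • v k + (N * v k - v k * N) + (E * v (k - 1) - v (k - 1) * E) = 0)
    (m : ℕ) : ∀ a : ℤ, ((a / n - (a + m) / n : ℤ) : ℂ) * uu hn v a (a + m) = 0 ∧
      (m ≠ 0 → uu hn v a (a + m) = 0) := by
  induction m with
  | zero => intro a; simp
  | succ m ih =>
    have hstep : ∀ a : ℤ, uu hn v (a - 1) (a - 1 + (m + 1)) = uu hn v a (a + (m + 1)) := by
      intro a
      have := uu_eq hn N E hNdef hEdef v hv a (a + m + 1)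
      rw [show a + (m : ℤ) + 1 - 1 = a + m by ring, (ih a).1] at this
      rw [show a - 1 + ((m : ℤ) + 1) = a + m by ring, ← add_assoc]
      linear_combination this
    have hconst : ∀ a : ℤ, uu hn v a (a + (m + 1)) = uu hn v 0 (0 + (m + 1)) := by
      intro a
      induction a using Int.induction_on with
      | zero => rfl
      | succ i ih => rw [← ih, ← hstep]; simp
      | pred i ih => rw [← ih, ← hstep (-(i : ℤ))]
    set c := uu hn v 0 (0 + (m + 1)) with hc
    have hsum : ∀ i : ℕ, (((i : ℤ) / n - ((i : ℤ) - (-(m + 1))) / n : ℤ) : ℂ) * c =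
        uu hn v ((i + 1 : ℕ) - 1) ((i + 1 : ℕ) - 1 + (m + 2))
        - uu hn v ((i : ℕ) - 1) ((i : ℕ) - 1 + (m + 2)) := by
      intro i
      have := uu_eq hn N E hNdef hEdef v hv i (i + (m + 2))
      rw [show (i : ℤ) + (m + 2) - 1 = i + (m + 1) by ring, hconst] at this
      rw [show (i : ℤ) - (-(m + 1)) = i + (m + 1) by ring,
        show (((i + 1 : ℕ) : ℤ) - 1) = i by push_cast; ring,
        show (i : ℤ) - 1 + (m + 2) = i + (m + 1) by ring]
      linear_combination this
    have tot := Finset.sum_range_sub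
      (fun i : ℕ => uu hn v ((i : ℤ) - 1) ((i : ℤ) - 1 + (m + 2))) n
    rw [← Finset.sum_congr rfl (fun i _ => hsum i), ← Finset.sum_mul] at tot
    have f1 := floor_sum hn 0
    have f2 := floor_sum hn (-(m + 1))
    simp only [sub_zero] at f1
    rw [← Int.cast_sum, Finset.sum_sub_distrib, f1, f2,
      show (n : ℤ) - 1 = ((0 : ℕ) - 1) + n by push_cast; ring,
      show ((0 : ℕ) - 1 : ℤ) + n + (m + 2) = ((0 : ℕ) - 1 + (m + 2)) + n by ring,
      uu_periodic, sub_self] at tot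
    have c0 : c = 0 := by
      rcases mul_eq_zero.1 tot with h | h
      · exfalso
        rw [Int.cast_eq_zero] at h
        omega
      · exact h
    intro a
    have := hconst a
    rw [c0] at this
    push_cast
    simp [this]

lemma neg_zero_sol (hn : 2 ≤ n) (N E : Matrix (Fin n) (Fin n) ℂ)
    (hNdef : ∀ i j : Fin n, N i j = if (i : ℕ) = (j : ℕ) + 1 then 1 else 0)
    (hEdef : ∀ i j : Fin n, E i j = if (i : ℕ) = 0 ∧ (j : ℕ) = n - 1 then 1 else 0)
    (v : ℤ → Matrix (Fin n) (Fin n) ℂ)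
    (hv : ∀ k : ℤ, (k : ℂ) • v k + (N * v k - v k * N) + (E * v (k - 1) - v (k - 1) * E) = 0)
    (k : ℤ) (hk : k < 0) : v k = 0 := by
  ext i j
  have hnz : (n : ℤ) ≠ 0 := by omega
  have hlt : (i : ℤ) < (j : ℤ) + n * (-k) := by
    have := i.2
    nlinarith
  obtain ⟨m, hm⟩ := Int.eq_ofNat_of_zero_le (sub_nonneg.2 hlt.le)
  have h := (uu_zero hn N E hNdef hEdef v hv m (i : ℕ)).2 (by rintro rfl; push_cast at hm; omega)
  rw [← hm, show ((i : ℕ) : ℤ) + ((j : ℕ) + n * (-k) - (i : ℕ)) = (j : ℕ) + n * (-k) by ring] at h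
  unfold uu at h
  rw [Int.add_mul_ediv_left _ _ hnz, Int.ediv_eq_zero_of_lt (by omega) (by have := i.2; omega),
    Int.ediv_eq_zero_of_lt (by omega) (by have := j.2; omega), res_fin] at h
  have hr : res n hn ((j : ℕ) + n * (-k)) = j := by
    refine Eq.trans ?_ (res_fin n hn j)
    apply Fin.ext; simp only [res, Int.add_mul_emod_self_left]
  rw [hr] at h
  simpa using h

lemma N_pow (N : Matrix (Fin n) (Fin n) ℂ)
    (hNdef : ∀ i j : Fin n, N i j = if (i : ℕ) = (j : ℕ) + 1 then 1 else 0) (m : ℕ) :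
    ∀ i j : Fin n, (N ^ m) i j = if (i : ℕ) = (j : ℕ) + m then 1 else 0 := by
  induction m with
  | zero => intro i j; simp [Matrix.one_apply, Fin.ext_iff]
  | succ m ih =>
    intro i j
    rw [pow_succ, Matrix.mul_apply]
    simp only [ih, hNdef]
    by_cases h : (j : ℕ) + 1 < n
    · rw [Finset.sum_eq_single ⟨(j : ℕ) + 1, h⟩]
      · simp only [if_true, mul_one]; congr 1; apply propext; omega
      · intro b _ hb
        rw [if_neg (c := (b : ℕ) = _), mul_zero]
        intro hh; exact hb (Fin.ext hh)
      · simp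
    · rw [if_neg (by omega)]
      apply Finset.sum_eq_zero
      intro b _
      rw [if_neg (c := (b : ℕ) = _), mul_zero]
      omega

/-- `k + ad N` -/
noncomputable def opk (N : Matrix (Fin n) (Fin n) ℂ) (k : ℂ) :
    Module.End ℂ (Matrix (Fin n) (Fin n) ℂ) :=
  algebraMap ℂ _ k + (LinearMap.mulLeft ℂ N - LinearMap.mulRight ℂ N)

lemma opk_apply (N : Matrix (Fin n) (Fin n) ℂ) (k : ℂ) (X : Matrix (Fin n) (Fin n) ℂ) :
    opk N k X = k • X + (N * X - X * N) := by
  simp [opk]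

lemma opk_unit (N : Matrix (Fin n) (Fin n) ℂ) (hN : IsNilpotent N) (k : ℂ) (hk : k ≠ 0) :
    IsUnit (opk N k) := by
  have hnil : IsNilpotent (LinearMap.mulLeft ℂ N - LinearMap.mulRight ℂ N) := by
    apply Commute.isNilpotent_sub (LinearMap.commute_mulLeft_right N N)
    · obtain ⟨m, hm⟩ := hN
      exact ⟨m, by rw [LinearMap.pow_mulLeft, hm]; simp⟩
    · obtain ⟨m, hm⟩ := hN
      exact ⟨m, by rw [LinearMap.pow_mulRight, hm]; simp⟩
  unfold opk
  exact hnil.isUnit_add_left_of_commute ((IsUnit.mk0 k hk).map _)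
    (Algebra.commutes k _).symm

lemma opk_bij (N : Matrix (Fin n) (Fin n) ℂ) (hN : IsNilpotent N) (k : ℂ) (hk : k ≠ 0) :
    Function.Bijective (opk N k) :=
  (Module.End.isUnit_iff _).1 (opk_unit N hN k hk)

lemma exists_sol (N E X : Matrix (Fin n) (Fin n) ℂ) (hN : IsNilpotent N)
    (htr : X.trace = 0) (hX : N * X = X * N) :
    ∃ v : ℤ → Matrix (Fin n) (Fin n) ℂ, v 0 = X ∧ (∀ k : ℤ, (v k).trace = 0) ∧
      ∀ k : ℤ, (k : ℂ) • v k + (N * v k - v k * N) + (E * v (k - 1) - v (k - 1) * E) = 0 := by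
  have hs : ∀ (k : ℕ) (Y : Matrix (Fin n) (Fin n) ℂ), ∃ Z, opk N (k + 1 : ℕ) Z = - (E * Y - Y * E) :=
    fun k Y => (opk_bij N hN _ (Nat.cast_ne_zero.2 (Nat.succ_ne_zero k))).2 _
  choose f hf using hs
  let w : ℕ → Matrix (Fin n) (Fin n) ℂ := fun k => Nat.rec X (fun k Y => f k Y) k
  have hw : ∀ k, w (k + 1) = f k (w k) := fun k => rfl
  let v : ℤ → Matrix (Fin n) (Fin n) ℂ := fun k => if k < 0 then 0 else w k.toNat
  have hv1 : ∀ k : ℕ, v k = w k := by intro k; simp [v]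
  have hv2 : ∀ k : ℤ, k < 0 → v k = 0 := by intro k hk; simp [v, hk]
  have hrec : ∀ k : ℤ, (k : ℂ) • v k + (N * v k - v k * N)
      + (E * v (k - 1) - v (k - 1) * E) = 0 := by
    intro k
    rcases lt_or_ge k 0 with h | h
    · rw [hv2 k h, hv2 (k - 1) (by omega)]; simp
    · obtain ⟨m, rfl⟩ := Int.eq_ofNat_of_zero_le h
      cases m with
      | zero =>
        rw [hv1 0, hv2 _ (by simp)]
        simp [w, hX]
      | succ m =>
        have := hf m (w m)
        rw [opk_apply] at this
        rw [show (((m + 1 : ℕ) : ℤ) - 1) = (m : ℤ) by push_cast; ring, hv1, hv1, hw]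
        rw [Int.cast_natCast, this]; simp
  refine ⟨v, hv1 0, ?_, hrec⟩
  intro k
  by_cases hk : k = 0
  · subst hk
    rw [show v 0 = X from hv1 0, htr]
  · have := congrArg Matrix.trace (hrec k)
    rw [Matrix.trace_add, Matrix.trace_add, Matrix.trace_sub, Matrix.trace_sub,
      Matrix.trace_mul_comm N, Matrix.trace_mul_comm E, Matrix.trace_smul] at this
    simpa [hk] using this

lemma mem_iff (N E : Matrix (Fin n) (Fin n) ℂ) (v : ℤ → Matrix (Fin n) (Fin n) ℂ) :
    v ∈ adjSolSpace n N E ↔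
        (∀ k : ℤ, (v k).trace = 0) ∧
        ∀ k : ℤ, (k : ℂ) • v k + (N * v k - v k * N) + (E * v (k - 1) - v (k - 1) * E) = 0 := by
  simp [adjSolSpace, Submodule.mem_inf, Submodule.mem_iInf]

lemma sol_zero (hn : 2 ≤ n) (N E : Matrix (Fin n) (Fin n) ℂ)
    (hNdef : ∀ i j : Fin n, N i j = if (i : ℕ) = (j : ℕ) + 1 then 1 else 0)
    (hEdef : ∀ i j : Fin n, E i j = if (i : ℕ) = 0 ∧ (j : ℕ) = n - 1 then 1 else 0)
    (hN : IsNilpotent N)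
    (v : ℤ → Matrix (Fin n) (Fin n) ℂ)
    (hv : ∀ k : ℤ, (k : ℂ) • v k + (N * v k - v k * N) + (E * v (k - 1) - v (k - 1) * E) = 0)
    (h0 : v 0 = 0) : v = 0 := by
  have hpos : ∀ m : ℕ, v m = 0 := by
    intro m
    induction m with
    | zero => simpa using h0
    | succ m ih =>
      have := hv ((m + 1 : ℕ) : ℤ)
      rw [show (((m + 1 : ℕ) : ℤ) - 1) = (m : ℤ) by push_cast; ring, ih, Int.cast_natCast] at this
      apply (opk_bij N hN _ (Nat.cast_ne_zero.2 (Nat.succ_ne_zero m))).1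
      rw [opk_apply, map_zero]
      simpa using this
  funext k
  rcases lt_or_ge k 0 with h | h
  · exact neg_zero_sol hn N E hNdef hEdef v hv k h
  · obtain ⟨m, rfl⟩ := Int.eq_ofNat_of_zero_le h
    exact hpos m

lemma centralizer_eq (hn : 2 ≤ n) (N : Matrix (Fin n) (Fin n) ℂ)
    (hNdef : ∀ i j : Fin n, N i j = if (i : ℕ) = (j : ℕ) + 1 then 1 else 0) :
    {X : Matrix (Fin n) (Fin n) ℂ | X.trace = 0 ∧ N * X = X * N}
        = ↑(Submodule.span ℂ
            {M : Matrix (Fin n) (Fin n) ℂ | ∃ j : ℕ, 1 ≤ j ∧ j ≤ n - 1 ∧ M = N ^ j}) := by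
  have hp := N_pow N hNdef
  apply Set.Subset.antisymm
  · rintro X ⟨htr, hX⟩
    have hcol : ∀ i j : Fin n, X i j = ∑ m : Fin n, X m ⟨0, by omega⟩ * (N ^ (m : ℕ)) i j := by
      intro i j
      have hc : (N ^ (j : ℕ) * X) i ⟨0, by omega⟩ = (X * N ^ (j : ℕ)) i ⟨0, by omega⟩ := by
        have : Commute (N ^ (j : ℕ)) X := Commute.pow_left hX _
        rw [this.eq]
      rw [Matrix.mul_apply, Matrix.mul_apply] at hc
      have e : ∑ m : Fin n, X i m * (N ^ (j : ℕ)) m ⟨0, by omega⟩ = X i j := by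
        rw [Finset.sum_eq_single j]
        · simp [hp]
        · intro b _ hb
          rw [hp, if_neg, mul_zero]
          simp only [zero_add]
          exact fun h => hb (Fin.ext h)
        · simp
      rw [← e, ← hc]
      apply Finset.sum_congr rfl
      intro m _
      rw [hp, hp, mul_comm, add_comm]
    have h00 : X ⟨0, by omega⟩ ⟨0, by omega⟩ = 0 := by
      have hd : ∀ i, X i i = X ⟨0, by omega⟩ ⟨0, by omega⟩ := by
        intro i
        rw [hcol i i, Finset.sum_eq_single ⟨0, by omega⟩]
        · simp
        · intro b _ hb
          rw [hp, if_neg, mul_zero]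
          intro h
          exact hb (Fin.ext (by simpa using h))
        · simp
      have : (n : ℂ) * X ⟨0, by omega⟩ ⟨0, by omega⟩ = 0 := by
        rw [← htr, Matrix.trace]
        simp only [Matrix.diag_apply]
        rw [Finset.sum_congr rfl (fun i _ => hd i)]
        simp
      rcases mul_eq_zero.1 this with h | h
      · rw [Nat.cast_eq_zero] at h; omega
      · exact h
    have hXs : X = ∑ m : Fin n, X m ⟨0, by omega⟩ • N ^ (m : ℕ) := by
      ext i j
      rw [Matrix.sum_apply, hcol]
      rfl
    rw [hXs]
    apply Submodule.sum_mem
    intro m _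
    by_cases hm : (m : ℕ) = 0
    · rw [show m = ⟨0, by omega⟩ from Fin.ext hm, h00, zero_smul]
      exact Submodule.zero_mem _
    · exact Submodule.smul_mem _ _ (Submodule.subset_span ⟨m, by omega, by have := m.2; omega, rfl⟩)
  · intro X hX
    induction hX using Submodule.span_induction with
    | mem x h =>
      obtain ⟨j, h1, h2, rfl⟩ := h
      refine ⟨?_, (Commute.self_pow N j).eq⟩
      rw [Matrix.trace]
      apply Finset.sum_eq_zero
      intro i _
      rw [Matrix.diag_apply, hp, if_neg (by omega)]
    | zero => simp
    | add x y _ _ hx hy =>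
      refine ⟨by rw [Matrix.trace_add, hx.1, hy.1, add_zero], ?_⟩
      rw [mul_add, add_mul, hx.2, hy.2]
    | smul c x _ hx =>
      refine ⟨by rw [Matrix.trace_smul, hx.1, smul_zero], ?_⟩
      rw [mul_smul_comm, smul_mul_assoc, hx.2]

lemma finrank_span_pow (hn : 2 ≤ n) (N : Matrix (Fin n) (Fin n) ℂ)
    (hNdef : ∀ i j : Fin n, N i j = if (i : ℕ) = (j : ℕ) + 1 then 1 else 0) :
    Module.finrank ℂ (Submodule.span ℂ
      {M : Matrix (Fin n) (Fin n) ℂ | ∃ j : ℕ, 1 ≤ j ∧ j ≤ n - 1 ∧ M = N ^ j}) = n - 1 := by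
  have hp := N_pow N hNdef
  have hset : {M : Matrix (Fin n) (Fin n) ℂ | ∃ j : ℕ, 1 ≤ j ∧ j ≤ n - 1 ∧ M = N ^ j}
      = Set.range (fun j : Fin (n - 1) => N ^ ((j : ℕ) + 1)) := by
    ext M
    constructor
    · rintro ⟨j, h1, h2, rfl⟩
      exact ⟨⟨j - 1, by omega⟩, by simp only; congr 1; omega⟩
    · rintro ⟨j, rfl⟩
      exact ⟨j + 1, by omega, by have := j.2; omega, rfl⟩
  have hli : LinearIndependent ℂ (fun j : Fin (n - 1) => N ^ ((j : ℕ) + 1)) := by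
    rw [Fintype.linearIndependent_iff]
    intro g hg i
    have h := congrFun (congrFun hg ⟨(i : ℕ) + 1, by have := i.2; omega⟩) ⟨0, by omega⟩
    rw [Matrix.sum_apply, Finset.sum_eq_single i] at h
    · simpa [hp] using h
    · intro b _ hb
      rw [Matrix.smul_apply, hp, if_neg, smul_zero]
      intro h
      simp only [zero_add, add_left_inj] at h
      exact hb (Fin.ext h.symm)
    · simp
  rw [hset, finrank_span_eq_card hli, Fintype.card_fin]

end FGAux

/-- For the adjoint representation of SL_n, evaluation at 0 maps the space of
adjoint solutions of the Frenkel–Gross recursion linearly and isomorphically onto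
the centralizer of N in sl_n, which is the span of N, N², …, N^{n−1}; in
particular the space of adjoint solutions has dimension n − 1, the rank of SL_n. -/
theorem stmt_14 (n : ℕ) (hn : 2 ≤ n)
    (N E : Matrix (Fin n) (Fin n) ℂ)
    (hNdef : ∀ i j : Fin n, N i j = if (i : ℕ) = (j : ℕ) + 1 then 1 else 0)
    (hEdef : ∀ i j : Fin n, E i j = if (i : ℕ) = 0 ∧ (j : ℕ) = n - 1 then 1 else 0) :
    (∀ v : ℤ → Matrix (Fin n) (Fin n) ℂ, v ∈ adjSolSpace n N E ↔
        (∀ k : ℤ, (v k).trace = 0) ∧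
        ∀ k : ℤ, (k : ℂ) • v k + (N * v k - v k * N) + (E * v (k - 1) - v (k - 1) * E) = 0)
    ∧ Function.Injective
        (fun v : adjSolSpace n N E => (v : ℤ → Matrix (Fin n) (Fin n) ℂ) 0)
    ∧ Set.range (fun v : adjSolSpace n N E => (v : ℤ → Matrix (Fin n) (Fin n) ℂ) 0)
        = {X : Matrix (Fin n) (Fin n) ℂ | X.trace = 0 ∧ N * X = X * N}
    ∧ {X : Matrix (Fin n) (Fin n) ℂ | X.trace = 0 ∧ N * X = X * N}
        = ↑(Submodule.span ℂ
            {M : Matrix (Fin n) (Fin n) ℂ | ∃ j : ℕ, 1 ≤ j ∧ j ≤ n - 1 ∧ M = N ^ j})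
    ∧ Module.finrank ℂ (adjSolSpace n N E) = n - 1 := by
  have hN : IsNilpotent N := by
    refine ⟨n, ?_⟩
    ext i j
    rw [FGAux.N_pow N hNdef, if_neg, Matrix.zero_apply]
    have := i.2
    omega
  have hinj : Function.Injective
      (fun v : adjSolSpace n N E => (v : ℤ → Matrix (Fin n) (Fin n) ℂ) 0) := by
    intro v w h
    have hm := (FGAux.mem_iff N E _).1 (v - w).2
    have hz := FGAux.sol_zero hn N E hNdef hEdef hN _ hm.2 (by
      simpa [sub_eq_zero] using h)
    exact sub_eq_zero.1 (Subtype.ext hz)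
  have hrange : Set.range (fun v : adjSolSpace n N E => (v : ℤ → Matrix (Fin n) (Fin n) ℂ) 0)
        = {X : Matrix (Fin n) (Fin n) ℂ | X.trace = 0 ∧ N * X = X * N} := by
    ext X
    constructor
    · rintro ⟨v, rfl⟩
      have hm := (FGAux.mem_iff N E _).1 v.2
      refine ⟨hm.1 0, ?_⟩
      have h := hm.2 0
      rw [FGAux.neg_zero_sol hn N E hNdef hEdef _ hm.2 (0 - 1) (by norm_num)] at h
      simpa [sub_eq_zero] using h
    · rintro ⟨htr, hX⟩
      obtain ⟨v, h0, h1, h2⟩ := FGAux.exists_sol N E X hN htr hX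
      exact ⟨⟨v, (FGAux.mem_iff N E v).2 ⟨h1, h2⟩⟩, h0⟩
  have hcent := FGAux.centralizer_eq hn N hNdef
  refine ⟨FGAux.mem_iff N E, hinj, hrange, hcent, ?_⟩
  let ev : adjSolSpace n N E →ₗ[ℂ] Matrix (Fin n) (Fin n) ℂ :=
    (LinearMap.proj (0 : ℤ)).comp (adjSolSpace n N E).subtype
  have hr : LinearMap.range ev = Submodule.span ℂ
      {M : Matrix (Fin n) (Fin n) ℂ | ∃ j : ℕ, 1 ≤ j ∧ j ≤ n - 1 ∧ M = N ^ j} := by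
    apply SetLike.coe_injective
    rw [← hcent, ← hrange]
    rfl
  rw [← FGAux.finrank_span_pow hn N hNdef, ← hr]
  exact (LinearMap.finrank_range_of_inj (f := ev) hinj).symm
end

section
/- The set of graded solutions y : ℤ → ℂ^n of the system (m·Id − J)·y(m) = −2(E+F)·y(m−1) (for all m ∈ ℤ) is a complex vector space on which the evaluation map y ↦ y(n) is a linear isomorphism onto ℂ^n; in particular the space of graded solutions has dimension n. -/
/-- The space of graded solutions y : ℤ → ℂ^n of the system
(m·Id − J)·y(m) = −2(E+F)·y(m−1), as a submodule of ℤ → ℂ^n. -/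
noncomputable def gradedSolSpace (n : ℕ) (J E F : Matrix (Fin n) (Fin n) ℂ) :
    Submodule ℂ (ℤ → Fin n → ℂ) :=
  ⨅ m : ℤ, LinearMap.ker
    ((m : ℂ) • (LinearMap.proj m : (ℤ → Fin n → ℂ) →ₗ[ℂ] (Fin n → ℂ))
      - J.mulVecLin.comp (LinearMap.proj m)
      + (2 : ℂ) • ((E + F).mulVecLin.comp (LinearMap.proj (m - 1))))

theorem aux_rec {V : Type*} (P : ℤ → V → V → Prop) (n : ℤ)
    (hup : ∀ m, n < m → ∀ w, ∃! u, P m u w) (hdn : ∀ m, m ≤ n → ∀ u, ∃! w, P m u w) (v : V) :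
    ∃! y : ℤ → V, y n = v ∧ ∀ m, P m (y m) (y (m - 1)) := by
  have h1 : ∀ m w, ∃ u, n < m → P m u w := by
    intro m w
    by_cases h : n < m
    · obtain ⟨u, hu, _⟩ := hup m h w
      exact ⟨u, fun _ => hu⟩
    · exact ⟨w, fun h' => absurd h' h⟩
  have h2 : ∀ m u, ∃ w, m ≤ n → P m u w := by
    intro m w
    by_cases h : m ≤ n
    · obtain ⟨u, hu, _⟩ := hdn m h w
      exact ⟨u, fun _ => hu⟩
    · exact ⟨w, fun h' => absurd h' h⟩
  choose f hf using h1
  choose g hg using h2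
  let a : ℕ → V := fun k => Nat.rec v (fun k x => f (n + k + 1) x) k
  let b : ℕ → V := fun k => Nat.rec v (fun k x => g (n - k) x) k
  have ha : ∀ k : ℕ, a (k + 1) = f (n + k + 1) (a k) := fun k => rfl
  have hb : ∀ k : ℕ, b (k + 1) = g (n - k) (b k) := fun k => rfl
  have ha0 : a 0 = v := rfl
  have hb0 : b 0 = v := rfl
  clear_value a b
  let y : ℤ → V := fun m => if n ≤ m then a (m - n).toNat else b (n - m).toNat
  have hya : ∀ k : ℕ, y (n + k) = a k := by
    intro k
    simp [y]
  have hyb : ∀ k : ℕ, y (n - k) = b k := by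
    intro k
    rcases Nat.eq_zero_or_pos k with rfl | hk
    · simp [y, ha0, hb0]
    · have : ¬ (n ≤ n - k) := by omega
      simp only [y, this, if_false]
      congr 1
      omega
  refine ⟨y, ⟨?_, ?_⟩, ?_⟩
  · simpa [ha0] using hya 0
  · intro m
    rcases lt_or_ge n m with h | h
    · obtain ⟨k, hk⟩ := Int.le.dest (show n + 1 ≤ m by omega)
      have e1 : y m = a (k + 1) := by
        rw [← hya, ← hk]; congr 1; push_cast; ring
      have e2 : y (m - 1) = a k := by
        rw [← hya, ← hk]; congr 1; ring
      rw [e1, e2, ha, show n + k + 1 = m by omega]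
      exact hf m _ h
    · obtain ⟨k, hk⟩ := Int.le.dest h
      have e1 : y m = b k := by
        rw [← hyb, ← hk]; congr 1; ring
      have e2 : y (m - 1) = b (k + 1) := by
        rw [← hyb, ← hk]; congr 1; push_cast; ring
      rw [e1, e2, hb, show n - k = m by omega]
      exact hg m _ h
  · rintro z ⟨hz, hP⟩
    have hza : ∀ k : ℕ, z (n + k) = a k := by
      intro k
      induction k with
      | zero => simpa [ha0] using hz
      | succ k ih =>
        have h := hP (n + k + 1)
        rw [show n + (k : ℤ) + 1 - 1 = n + k by ring, ih] at h
        rw [ha]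
        push_cast
        rw [← add_assoc]
        exact (hup (n + k + 1) (by omega) (a k)).unique h (hf _ _ (by omega))
    have hzb : ∀ k : ℕ, z (n - k) = b k := by
      intro k
      induction k with
      | zero => simpa [hb0] using hz
      | succ k ih =>
        have h := hP (n - k)
        rw [ih] at h
        rw [hb]
        push_cast
        rw [← sub_sub]
        exact (hdn (n - k) (by omega) (b k)).unique h (hg _ _ (by omega))
    funext m
    rcases le_total n m with h | h
    · obtain ⟨k, rfl⟩ := Int.le.dest h
      rw [hza, hya]
    · obtain ⟨k, hk⟩ := Int.le.dest h
      rw [show m = n - k by omega, hzb, hyb]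

theorem aux_inj (n : ℕ) (hne : Even n)
    (E F : Matrix (Fin n) (Fin n) ℂ)
    (hFdef : ∀ i j : Fin n, F i j = if (i : ℕ) = (j : ℕ) + 1 then 1 else 0)
    (hEdef : ∀ i j : Fin n, E i j =
      if (j : ℕ) = (i : ℕ) + 1 then (((j : ℕ) * (n - (j : ℕ)) : ℕ) : ℂ) else 0)
    (v : Fin n → ℂ) (hv : (E + F).mulVec v = 0) : v = 0 := by
  let w : ℕ → ℂ := fun k => if h : k < n then v ⟨k, h⟩ else 0
  have hw : ∀ i : Fin n, v i = w i := by
    intro i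
    simp [w]
  have hE : ∀ i : Fin n, E.mulVec v i = (((i + 1 : ℕ) * (n - (i + 1 : ℕ)) : ℕ) : ℂ) * w (i + 1) := by
    intro i
    simp only [Matrix.mulVec, dotProduct, hEdef]
    by_cases h : (i : ℕ) + 1 < n
    · rw [Finset.sum_eq_single (⟨i + 1, h⟩ : Fin n)]
      · simp [w, h]
      · intro j _ hj
        rw [if_neg, zero_mul]
        intro h'
        exact hj (Fin.ext h')
      · simp
    · rw [Finset.sum_eq_zero]
      · simp [w, h]
      · intro j _
        rw [if_neg, zero_mul]
        have := j.2
        omega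
  have hF0 : ∀ i : Fin n, (i : ℕ) = 0 → F.mulVec v i = 0 := by
    intro i hi
    simp only [Matrix.mulVec, dotProduct, hFdef]
    rw [Finset.sum_eq_zero]
    intro j _
    rw [if_neg, zero_mul]
    omega
  have hF : ∀ (i : Fin n) (k : ℕ), (i : ℕ) = k + 1 → F.mulVec v i = w k := by
    intro i k hi
    have hk : k < n := by have := i.2; omega
    simp only [Matrix.mulVec, dotProduct, hFdef]
    rw [Finset.sum_eq_single (⟨k, hk⟩ : Fin n)]
    · simp [w, hk, hi]
    · intro j _ hj
      rw [if_neg, zero_mul]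
      intro h'
      exact hj (Fin.ext (by simp; omega))
    · simp
  have hrow : ∀ i : Fin n, E.mulVec v i + F.mulVec v i = 0 := by
    intro i
    have := congrFun hv i
    rwa [Matrix.add_mulVec] at this
  have hbig : ∀ k, n ≤ k → w k = 0 := by
    intro k hk
    simp [w, not_lt.mpr hk]
  have hodd : ∀ k, w (2 * k + 1) = 0 := by
    intro k
    induction k with
    | zero =>
      by_cases h : 1 < n
      · have := hrow ⟨0, by omega⟩
        rw [hE, hF0 _ rfl] at this
        simp only [add_zero, zero_add, mul_eq_zero, Nat.cast_eq_zero] at this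
        rcases this with h' | h'
        · omega
        · exact h'
      · exact hbig _ (by omega)
    | succ k ih =>
      by_cases h : 2 * (k + 1) + 1 < n
      · have := hrow ⟨2 * k + 2, by omega⟩
        rw [hE, hF _ (2 * k + 1) rfl, ih] at this
        simp only [add_zero, mul_eq_zero, Nat.cast_eq_zero] at this
        rcases this with h' | h'
        · omega
        · exact h'
      · exact hbig _ (by omega)
  have heven : ∀ d k, n ≤ 2 * (k + d) → w (2 * k) = 0 := by
    intro d
    induction d with
    | zero => intro k hk; exact hbig _ (by omega)
    | succ d ih =>
      intro k hk
      by_cases h : 2 * k + 1 < n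
      · have := hrow ⟨2 * k + 1, h⟩
        rw [hE, hF _ (2 * k) rfl] at this
        simp only at this
        rw [show 2 * k + 1 + 1 = 2 * (k + 1) by ring, ih (k + 1) (by omega)] at this
        simpa using this
      · obtain ⟨r, hr⟩ := hne
        exact hbig _ (by omega)
  funext i
  rw [hw]
  rcases Nat.even_or_odd' (i : ℕ) with ⟨k, h | h⟩
  · rw [h]; exact heven n k (by omega)
  · rw [h]; exact hodd k

/-- For the irreducible SL₂-representation Sym^{n−1}ℂ² with n even, the space of
graded solutions of (m·Id − J)·y(m) = −2(E+F)·y(m−1) is mapped by evaluation at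
m = n linearly and bijectively onto ℂ^n; in particular it has dimension n. -/
theorem stmt_15 (n : ℕ) (hn : 2 ≤ n) (hne : Even n)
    (J E F : Matrix (Fin n) (Fin n) ℂ)
    (hJdef : J = Matrix.diagonal (fun i : Fin n => ((i : ℕ) + 1 : ℂ)))
    (hFdef : ∀ i j : Fin n, F i j = if (i : ℕ) = (j : ℕ) + 1 then 1 else 0)
    (hEdef : ∀ i j : Fin n, E i j =
      if (j : ℕ) = (i : ℕ) + 1 then (((j : ℕ) * (n - (j : ℕ)) : ℕ) : ℂ) else 0) :
    (∀ y : ℤ → Fin n → ℂ, y ∈ gradedSolSpace n J E F ↔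
        ∀ m : ℤ, (m : ℂ) • y m - J.mulVec (y m) = (-2 : ℂ) • (E + F).mulVec (y (m - 1)))
    ∧ Function.Bijective
        (fun y : gradedSolSpace n J E F => (y : ℤ → Fin n → ℂ) (n : ℤ))
    ∧ Module.finrank ℂ (gradedSolSpace n J E F) = n := by
  have hmem : ∀ y : ℤ → Fin n → ℂ, y ∈ gradedSolSpace n J E F ↔
        ∀ m : ℤ, (m : ℂ) • y m - J.mulVec (y m) = (-2 : ℂ) • (E + F).mulVec (y (m - 1)) := by
    intro y
    simp only [gradedSolSpace, Submodule.mem_iInf, LinearMap.mem_ker, LinearMap.add_apply,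
      LinearMap.sub_apply, LinearMap.smul_apply, LinearMap.comp_apply, LinearMap.proj_apply,
      Matrix.mulVecLin_apply]
    refine forall_congr' fun m => ?_
    rw [neg_smul, ← sub_eq_zero (b := -_), sub_neg_eq_add]
  have hMinj : Function.Injective (E + F).mulVecLin := by
    rw [injective_iff_map_eq_zero]
    intro v hv
    exact aux_inj n hne E F hFdef hEdef v hv
  have hMsurj : Function.Surjective (E + F).mulVecLin := LinearMap.injective_iff_surjective.mp hMinj
  have key := aux_rec (V := Fin n → ℂ)
    (fun m u w => (m : ℂ) • u - J.mulVec u = (-2 : ℂ) • (E + F).mulVec w) (n : ℤ) (by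
      intro m hm w
      have hne0 : ∀ i : Fin n, (m : ℂ) - ((i : ℕ) + 1 : ℂ) ≠ 0 := by
        intro i h
        have h2 : ((m - ((i : ℕ) + 1) : ℤ) : ℂ) = 0 := by push_cast; exact h
        have h3 := Int.cast_eq_zero.mp h2
        have := i.2
        omega
      have heq : ∀ u : Fin n → ℂ, ((m : ℂ) • u - J.mulVec u = (-2 : ℂ) • (E + F).mulVec w) ↔
          u = fun i => ((-2 : ℂ) • (E + F).mulVec w) i / ((m : ℂ) - ((i : ℕ) + 1 : ℂ)) := by
        intro u
        rw [funext_iff, funext_iff]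
        refine forall_congr' fun i => ?_
        rw [eq_div_iff (hne0 i), hJdef, Pi.sub_apply, Matrix.mulVec_diagonal, Pi.smul_apply (m : ℂ),
          smul_eq_mul, mul_comm (u i), sub_mul]
      refine ⟨_, (heq _).mpr rfl, fun u hu => (heq u).mp hu⟩) (by
      intro m _ u
      obtain ⟨w, hw⟩ := hMsurj ((-2 : ℂ)⁻¹ • ((m : ℂ) • u - J.mulVec u))
      rw [Matrix.mulVecLin_apply] at hw
      have hw' : (m : ℂ) • u - J.mulVec u = (-2 : ℂ) • (E + F).mulVec w := by
        rw [hw, smul_inv_smul₀ (by norm_num)]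
      refine ⟨w, hw', fun z hz => hMinj ?_⟩
      have hz' : (m : ℂ) • u - J.mulVec u = (-2 : ℂ) • (E + F).mulVec z := hz
      rw [hw'] at hz'
      exact (smul_right_injective _ (by norm_num : (-2 : ℂ) ≠ 0) hz').symm)
  have hbij : Function.Bijective
        (fun y : gradedSolSpace n J E F => (y : ℤ → Fin n → ℂ) (n : ℤ)) := by
    constructor
    · intro y z hyz
      exact Subtype.ext ((key ((z : ℤ → Fin n → ℂ) n)).unique ⟨hyz, (hmem _).mp y.2⟩
        ⟨rfl, (hmem _).mp z.2⟩)
    · intro v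
      obtain ⟨y, ⟨h1, h2⟩, _⟩ := key v
      exact ⟨⟨y, (hmem y).mpr h2⟩, h1⟩
  refine ⟨hmem, hbij, ?_⟩
  let L : gradedSolSpace n J E F →ₗ[ℂ] (Fin n → ℂ) :=
    (LinearMap.proj (n : ℤ) : (ℤ → Fin n → ℂ) →ₗ[ℂ] (Fin n → ℂ)).comp
      (gradedSolSpace n J E F).subtype
  have hL : Function.Bijective L := hbij
  rw [(LinearEquiv.ofBijective L hL).finrank_eq]
  simp
end

section
/- The set of graded solutions y : ℤ → ℂ^n of the system (m·Id − J)·y(m) = −2(E+F)·y(m−1) for which there exists an integer M with y(m) = 0 for all m < M is a one-dimensional complex vector space; moreover every such solution satisfies y(m) = 0 for all m < n and y(n) ∈ ℂ·e_n. -/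
noncomputable def solAux (n : ℕ) (A : Matrix (Fin n) (Fin n) ℂ) (v : Fin n → ℂ) : ℕ → Fin n → ℂ
  | 0 => v
  | k + 1 => fun i => (-2 : ℂ) * (A.mulVec (solAux n A v k)) i / ((n : ℂ) + k - (i : ℕ))

lemma coef_ne (n k : ℕ) (i : Fin n) : ((n : ℂ) + k - (i : ℕ)) ≠ 0 := by
  intro h
  have h2 : ((n + k : ℕ) : ℂ) = ((i : ℕ) : ℂ) := by push_cast; linear_combination h
  have h3 : n + k = (i : ℕ) := by exact_mod_cast h2
  have := i.2
  omega

/-- For the irreducible SL₂-representation Sym^{n−1}ℂ² with n even, the graded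
solutions of (m·Id − J)·y(m) = −2(E+F)·y(m−1) which vanish for all sufficiently
negative m form a one-dimensional complex vector space; every such solution
vanishes in all degrees m < n and its component in degree n lies on the line
ℂ·e_n. -/
theorem stmt_17 (n : ℕ) (hn : 2 ≤ n) (hne : Even n)
    (J E F : Matrix (Fin n) (Fin n) ℂ)
    (hJdef : J = Matrix.diagonal (fun i : Fin n => ((i : ℕ) + 1 : ℂ)))
    (hFdef : ∀ i j : Fin n, F i j = if (i : ℕ) = (j : ℕ) + 1 then 1 else 0)
    (hEdef : ∀ i j : Fin n, E i j =
      if (j : ℕ) = (i : ℕ) + 1 then (((j : ℕ) * (n - (j : ℕ)) : ℕ) : ℂ) else 0) :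
    (∀ y : ℤ → Fin n → ℂ,
      (∀ m : ℤ, (m : ℂ) • y m - J.mulVec (y m) = (-2 : ℂ) • (E + F).mulVec (y (m - 1))) →
      (∃ M : ℤ, ∀ m : ℤ, m < M → y m = 0) →
        (∀ m : ℤ, m < (n : ℤ) → y m = 0)
        ∧ ∃ c : ℂ, y (n : ℤ)
            = c • (Pi.single (⟨n - 1, by omega⟩ : Fin n) (1 : ℂ) : Fin n → ℂ))
    ∧ ∃ y₀ : ℤ → Fin n → ℂ,
        (∀ m : ℤ, (m : ℂ) • y₀ m - J.mulVec (y₀ m) = (-2 : ℂ) • (E + F).mulVec (y₀ (m - 1)))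
        ∧ (∃ M : ℤ, ∀ m : ℤ, m < M → y₀ m = 0)
        ∧ y₀ ≠ 0
        ∧ ∀ y : ℤ → Fin n → ℂ,
            (∀ m : ℤ, (m : ℂ) • y m - J.mulVec (y m) = (-2 : ℂ) • (E + F).mulVec (y (m - 1))) →
            (∃ M : ℤ, ∀ m : ℤ, m < M → y m = 0) →
            ∃ c : ℂ, y = c • y₀ := by
  have hcomp : ∀ y : ℤ → Fin n → ℂ, ∀ m : ℤ,
      ((m : ℂ) • y m - J.mulVec (y m) = (-2 : ℂ) • (E + F).mulVec (y (m - 1))) ↔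
      ∀ i : Fin n, ((m : ℂ) - ((i : ℕ) + 1)) * y m i
        = (-2 : ℂ) * ((E + F).mulVec (y (m - 1))) i := by
    intro y m
    rw [funext_iff]
    refine forall_congr' fun i => ?_
    simp only [hJdef, Pi.sub_apply, Pi.smul_apply, Matrix.mulVec_diagonal, smul_eq_mul, sub_mul]
  simp only [hcomp]
  -- one step: the previous component vanishes
  have hstep : ∀ y : ℤ → Fin n → ℂ,
      (∀ m : ℤ, ∀ i : Fin n, ((m : ℂ) - ((i : ℕ) + 1)) * y m i
        = (-2 : ℂ) * ((E + F).mulVec (y (m - 1))) i) →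
      ∀ m : ℤ, y (m - 1) = 0 → ∀ i : Fin n, m ≠ (i : ℕ) + 1 → y m i = 0 := by
    intro y hy m h0 i hi
    have h := hy m i
    rw [h0] at h
    simp only [Matrix.mulVec_zero, Pi.zero_apply, mul_zero, mul_eq_zero] at h
    rcases h with h | h
    · exfalso
      apply hi
      have : (m : ℂ) = (((i : ℕ) + 1 : ℤ) : ℂ) := by push_cast; linear_combination h
      exact_mod_cast this
    · exact h
  have hvan : ∀ y : ℤ → Fin n → ℂ,
      (∀ m : ℤ, ∀ i : Fin n, ((m : ℂ) - ((i : ℕ) + 1)) * y m i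
        = (-2 : ℂ) * ((E + F).mulVec (y (m - 1))) i) →
      (∃ M : ℤ, ∀ m : ℤ, m < M → y m = 0) → ∀ m : ℤ, m < (n : ℤ) → y m = 0 := by
    rintro y hy ⟨M, hM⟩
    have key : ∀ m : ℤ, m < n → y (m - 1) = 0 → y m = 0 := by
      intro m hm h0
      have hz := hstep y hy m h0
      funext i
      by_cases hi : m = (i : ℕ) + 1
      · have hlt : (i : ℕ) + 1 < n := by omega
        have h := hy (m + 1) ⟨(i : ℕ) + 1, hlt⟩
        have hc : (((m + 1 : ℤ) : ℂ) - ((((i : ℕ) + 1 : ℕ) : ℂ) + 1)) = 0 := by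
          rw [hi]; push_cast; ring
        simp only [hc, zero_mul, add_sub_cancel_right] at h
        have hs : ((E + F).mulVec (y m)) ⟨(i : ℕ) + 1, hlt⟩ = y m i := by
          unfold Matrix.mulVec dotProduct
          rw [Finset.sum_eq_single i]
          · have hno : ¬ ((i : ℕ) = (i : ℕ) + 1 + 1) := by omega
            simp [hEdef, hFdef, hno]
          · intro j _ hj
            rw [hz j, mul_zero]
            intro hj2
            apply hj
            apply Fin.ext
            omega
          · simp
        rw [hs] at h
        simpa using h.symm
      · exact hz i hi
    have ind : ∀ k : ℕ, M - 1 + k < n → y (M - 1 + k) = 0 := by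
      intro k
      induction k with
      | zero => intro _; exact hM _ (by simp)
      | succ k ih =>
        intro hk
        apply key _ hk
        have e : M - 1 + ((k + 1 : ℕ) : ℤ) - 1 = M - 1 + k := by push_cast; ring
        rw [e]
        apply ih
        push_cast at hk
        omega
    intro m hm
    by_cases hmM : m < M
    · exact hM m hmM
    · have e : m = M - 1 + ((m - M + 1).toNat : ℤ) := by omega
      rw [e]
      apply ind
      omega
  have htop : ∀ y : ℤ → Fin n → ℂ,
      (∀ m : ℤ, ∀ i : Fin n, ((m : ℂ) - ((i : ℕ) + 1)) * y m i
        = (-2 : ℂ) * ((E + F).mulVec (y (m - 1))) i) →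
      (∃ M : ℤ, ∀ m : ℤ, m < M → y m = 0) → ∃ c : ℂ, y (n : ℤ)
            = c • (Pi.single (⟨n - 1, by omega⟩ : Fin n) (1 : ℂ) : Fin n → ℂ) := by
    intro y hy hM
    refine ⟨y n ⟨n - 1, by omega⟩, ?_⟩
    funext i
    by_cases hi : i = ⟨n - 1, by omega⟩
    · subst hi; simp
    · rw [hstep y hy n (hvan y hy hM _ (by omega)) i]
      · simp [Pi.single_eq_of_ne hi]
      · intro h
        apply hi
        apply Fin.ext
        simp only
        omega
  refine ⟨fun y hy hM => ⟨hvan y hy hM, htop y hy hM⟩, ?_⟩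
  set e : Fin n → ℂ := Pi.single (⟨n - 1, by omega⟩ : Fin n) (1 : ℂ) with he
  have hlow : ∀ m : ℤ, m < n →
      (fun m : ℤ => if m < n then 0 else solAux n (E + F) e (m - n).toNat) m = 0 := by
    intro m hm
    simp [hm]
  have hhigh : ∀ k : ℕ,
      (fun m : ℤ => if m < n then 0 else solAux n (E + F) e (m - n).toNat) (n + k)
        = solAux n (E + F) e k := by
    intro k
    simp
  generalize (fun m : ℤ => if m < n then 0 else solAux n (E + F) e (m - n).toNat) = y₀ at hlow hhigh
  have hn0 : y₀ n = e := by simpa [solAux] using hhigh 0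
  refine ⟨y₀, ?_, ⟨n, hlow⟩, ?_, ?_⟩
  · intro m i
    rcases lt_trichotomy m n with hm | hm | hm
    · rw [hlow m hm, hlow (m - 1) (by omega)]
      simp
    · rw [hm, hlow ((n : ℤ) - 1) (by omega), hn0]
      by_cases hi : i = ⟨n - 1, by omega⟩
      · subst hi
        have : ((n - 1 : ℕ) : ℂ) + 1 = n := by
          have : n - 1 + 1 = n := by omega
          exact_mod_cast this
        simp [this]
      · simp [he, Pi.single_eq_of_ne hi]
    · obtain ⟨k, rfl⟩ : ∃ k : ℕ, m = n + ((k + 1 : ℕ) : ℤ) := ⟨(m - n - 1).toNat, by omega⟩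
      have e1 : (n : ℤ) + ((k + 1 : ℕ) : ℤ) - 1 = n + (k : ℤ) := by push_cast; ring
      rw [e1, hhigh, hhigh]
      have hne := coef_ne n k i
      have e2 : (((n : ℤ) + ((k + 1 : ℕ) : ℤ) : ℤ) : ℂ) - ((i : ℕ) + 1)
          = (n : ℂ) + k - (i : ℕ) := by push_cast; ring
      rw [e2]
      simp only [solAux]
      field_simp
  · intro h
    have h1 := congrFun (congrFun h n) ⟨n - 1, by omega⟩
    rw [hn0] at h1
    simp [he] at h1
  · intro y hy hM
    obtain ⟨c, hc⟩ := htop y hy hM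
    refine ⟨c, ?_⟩
    have hk : ∀ k : ℕ, y (n + k) = c • solAux n (E + F) e k := by
      intro k
      induction k with
      | zero => simpa [solAux] using hc
      | succ k ih =>
        funext i
        have h := hy (n + ((k + 1 : ℕ) : ℤ)) i
        have e1 : (n : ℤ) + ((k + 1 : ℕ) : ℤ) - 1 = n + (k : ℤ) := by push_cast; ring
        have e2 : (((n : ℤ) + ((k + 1 : ℕ) : ℤ) : ℤ) : ℂ) - ((i : ℕ) + 1)
            = (n : ℂ) + k - (i : ℕ) := by push_cast; ring
        rw [e1, ih, e2, Matrix.mulVec_smul] at h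
        have hne := coef_ne n k i
        simp only [Pi.smul_apply, smul_eq_mul, solAux] at h ⊢
        field_simp
        linear_combination h
    funext m
    by_cases hm : m < n
    · simp [hvan y hy hM m hm, hlow m hm]
    · obtain ⟨k, rfl⟩ : ∃ k : ℕ, m = n + (k : ℤ) := ⟨(m - n).toNat, by omega⟩
      rw [hk, Pi.smul_apply, hhigh]
end

section
/- Let V_even ⊂ ℂ^n be the span of the standard basis vectors e_i with i even and V_odd the span of those with i odd. A graded solution y : ℤ → ℂ^n of the system (m·Id − J)·y(m) = −2(E+F)·y(m−1) satisfies y(m) ∈ V_even for every even m and y(m) ∈ V_odd for every odd m if and only if y(n) ∈ V_even. (This characterizes which solutions on the double cover descend to the original punctured line.) -/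
theorem span_single_mem (n : ℕ) (p : ℕ → Prop) (v : Fin n → ℂ) :
    v ∈ Submodule.span ℂ {w : Fin n → ℂ | ∃ i : Fin n, p ((i : ℕ) + 1) ∧ w = Pi.single i (1 : ℂ)} ↔
      ∀ i : Fin n, ¬ p ((i : ℕ) + 1) → v i = 0 := by
  constructor
  · intro h
    induction h using Submodule.span_induction with
    | mem x hx =>
      obtain ⟨j, hj, rfl⟩ := hx
      intro i hi
      have : i ≠ j := by rintro rfl; exact hi hj
      simp [Pi.single_apply, this]
    | zero => intro i _; rfl
    | add x y _ _ hx hy => intro i hi; simp [hx i hi, hy i hi]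
    | smul a x _ hx => intro i hi; simp [hx i hi]
  · intro h
    have hv : v = ∑ i, v i • (Pi.single i (1 : ℂ) : Fin n → ℂ) := by
      ext j
      simp [Finset.sum_apply, Pi.single_apply]
    rw [hv]
    refine Submodule.sum_mem _ fun i _ => ?_
    by_cases hi : p ((i : ℕ) + 1)
    · exact Submodule.smul_mem _ _ (Submodule.subset_span ⟨i, hi, rfl⟩)
    · rw [h i hi, zero_smul]
      exact Submodule.zero_mem _

/-- Extension of a vector by zero to all natural indices. -/
noncomputable def extZ {n : ℕ} (v : Fin n → ℂ) (k : ℕ) : ℂ := if h : k < n then v ⟨k, h⟩ else 0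

theorem extZ_sum {n : ℕ} (v : Fin n → ℂ) (k : ℕ) (c : ℂ) :
    ∑ j : Fin n, (if (j : ℕ) = k then c else 0) * v j = c * extZ v k := by
  unfold extZ
  split_ifs with h
  · rw [Finset.sum_eq_single (⟨k, h⟩ : Fin n)]
    · simp
    · intro b _ hb
      have : (b : ℕ) ≠ k := fun hh => hb (Fin.ext hh)
      simp [this]
    · simp
  · rw [mul_zero]
    refine Finset.sum_eq_zero fun j _ => ?_
    have : (j : ℕ) ≠ k := by have := j.2; omega
    simp [this]

theorem row_mul {n : ℕ} (E F : Matrix (Fin n) (Fin n) ℂ)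
    (hFdef : ∀ i j : Fin n, F i j = if (i : ℕ) = (j : ℕ) + 1 then 1 else 0)
    (hEdef : ∀ i j : Fin n, E i j =
      if (j : ℕ) = (i : ℕ) + 1 then (((j : ℕ) * (n - (j : ℕ)) : ℕ) : ℂ) else 0)
    (v : Fin n → ℂ) (i : Fin n) :
    (E + F).mulVec v i = ((((i : ℕ) + 1) * (n - ((i : ℕ) + 1)) : ℕ) : ℂ) * extZ v ((i : ℕ) + 1)
      + if (i : ℕ) = 0 then 0 else extZ v ((i : ℕ) - 1) := by
  rw [Matrix.add_mulVec, Pi.add_apply]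
  congr 1
  · rw [← extZ_sum]
    simp only [Matrix.mulVec, dotProduct]
    refine Finset.sum_congr rfl fun j _ => ?_
    rw [hEdef]
    split_ifs with h
    · rw [h]
    · rfl
  · simp only [Matrix.mulVec, dotProduct]
    split_ifs with h
    · refine Finset.sum_eq_zero fun j _ => ?_
      rw [hFdef, if_neg (by omega), zero_mul]
    · rw [← one_mul (extZ v _), ← extZ_sum]
      refine Finset.sum_congr rfl fun j _ => ?_
      rw [hFdef]
      congr 1
      have : (i : ℕ) = (j : ℕ) + 1 ↔ (j : ℕ) = (i : ℕ) - 1 := by omega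
      simp only [this]

theorem core (n : ℕ) (hne : Even n) (z : ℤ → ℕ → ℂ) (hz : ∀ m k, n ≤ k → z m k = 0)
    (h : ∀ (m : ℤ) (k : ℕ), k < n → ((m : ℂ) - (k + 1)) * z m k =
      -2 * ((((k + 1) * (n - (k + 1)) : ℕ) : ℂ) * z (m - 1) (k + 1)
        + if k = 0 then 0 else z (m - 1) (k - 1)))
    (h0 : ∀ k : ℕ, Even ((n : ℤ) + k) → z n k = 0) :
    ∀ (m : ℤ) (k : ℕ), Even (m + k) → z m k = 0 := by
  intro m
  induction m using Int.inductionOn' (b := (n : ℤ)) with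
  | zero => exact h0
  | succ m _ ih =>
    intro k hk
    by_cases hkn : k < n
    · have h1 := h (m + 1) k hkn
      have e : m + 1 - 1 = m := by ring
      rw [e, ih (k + 1) (by push_cast; convert hk using 1; ring)] at h1
      have h2 : (if k = 0 then (0 : ℂ) else z m (k - 1)) = 0 := by
        split_ifs with hk0
        · rfl
        · apply ih
          rw [Int.even_iff] at hk ⊢
          omega
      rw [h2] at h1
      have h3 : (((m + 1 : ℤ) : ℂ) - (k + 1)) ≠ 0 := by
        intro hh
        have : ((m + 1 - (k + 1) : ℤ) : ℂ) = 0 := by push_cast at hh ⊢; exact hh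
        rw [Int.cast_eq_zero] at this
        rw [Int.even_iff] at hk
        omega
      rw [mul_zero, add_zero, mul_zero] at h1
      exact (mul_eq_zero.1 h1).resolve_left h3
    · exact hz _ _ (by omega)
  | pred m _ ih =>
    have row : ∀ k : ℕ, k < n → Even (m + k) →
        (((k + 1) * (n - (k + 1)) : ℕ) : ℂ) * z (m - 1) (k + 1)
        + (if k = 0 then 0 else z (m - 1) (k - 1)) = 0 := by
      intro k hk he
      have h1 := h m k hk
      rw [ih k he, mul_zero] at h1
      have h2 : (-2 : ℂ) ≠ 0 := by norm_num
      exact (mul_eq_zero.1 h1.symm).resolve_left h2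
    intro k hk
    by_cases hkn : n ≤ k
    · exact hz _ _ hkn
    push Not at hkn
    obtain ⟨N, rfl⟩ := hne
    rcases Nat.even_or_odd' k with ⟨a, rfl | rfl⟩
    · obtain ⟨d, hd⟩ : ∃ d, a + d = N := ⟨N - a, by omega⟩
      clear hkn
      induction d generalizing a with
      | zero => exact hz _ _ (by omega)
      | succ d ihd =>
        have h1 := row (2 * a + 1) (by omega) (by
          rw [Int.even_iff] at hk ⊢; push_cast at hk ⊢; omega)
        have h2 := ihd (a + 1) (by
          rw [Int.even_iff] at hk ⊢; push_cast at hk ⊢; omega) (by omega)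
        have e : 2 * a + 1 + 1 = 2 * (a + 1) := by ring
        rw [e, h2] at h1
        simpa using h1
    · induction a with
      | zero =>
        have h1 := row 0 (by omega) (by
          rw [Int.even_iff] at hk ⊢; push_cast at hk ⊢; omega)
        have hc : (((0 + 1) * (N + N - (0 + 1)) : ℕ) : ℂ) ≠ 0 := by
          rw [Nat.cast_ne_zero]; omega
        rw [if_pos rfl, add_zero] at h1
        exact (mul_eq_zero.1 h1).resolve_left hc
      | succ a iha =>
        have h1 := row (2 * (a + 1)) (by omega) (by
          rw [Int.even_iff] at hk ⊢; push_cast at hk ⊢; omega)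
        have h2 := iha (by
          rw [Int.even_iff] at hk ⊢; push_cast at hk ⊢; omega) (by omega)
        have hc : (((2 * (a + 1) + 1) * (N + N - (2 * (a + 1) + 1)) : ℕ) : ℂ) ≠ 0 := by
          rw [Nat.cast_ne_zero]
          exact Nat.mul_ne_zero (by omega) (by omega)
        have e : 2 * (a + 1) - 1 = 2 * a + 1 := by omega
        rw [if_neg (by omega), e, h2, add_zero] at h1
        exact (mul_eq_zero.1 h1).resolve_left hc

/-- For the irreducible SL₂-representation Sym^{n−1}ℂ² with n even, a graded
solution of (m·Id − J)·y(m) = −2(E+F)·y(m−1) has all its even-degree components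
in V_even (the span of the standard basis vectors e_i with i even, 1-based) and
all its odd-degree components in V_odd if and only if its component in degree n
lies in V_even.  (This characterizes which solutions on the double cover descend
to the original punctured line.) -/
theorem stmt_18 (n : ℕ) (hn : 2 ≤ n) (hne : Even n)
    (J E F : Matrix (Fin n) (Fin n) ℂ)
    (hJdef : J = Matrix.diagonal (fun i : Fin n => ((i : ℕ) + 1 : ℂ)))
    (hFdef : ∀ i j : Fin n, F i j = if (i : ℕ) = (j : ℕ) + 1 then 1 else 0)
    (hEdef : ∀ i j : Fin n, E i j =
      if (j : ℕ) = (i : ℕ) + 1 then (((j : ℕ) * (n - (j : ℕ)) : ℕ) : ℂ) else 0)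
    (Veven Vodd : Submodule ℂ (Fin n → ℂ))
    (hVeven : Veven = Submodule.span ℂ
      {w : Fin n → ℂ | ∃ i : Fin n, Even ((i : ℕ) + 1) ∧ w = Pi.single i (1 : ℂ)})
    (hVodd : Vodd = Submodule.span ℂ
      {w : Fin n → ℂ | ∃ i : Fin n, Odd ((i : ℕ) + 1) ∧ w = Pi.single i (1 : ℂ)})
    (y : ℤ → Fin n → ℂ)
    (hy : ∀ m : ℤ, (m : ℂ) • y m - J.mulVec (y m) = (-2 : ℂ) • (E + F).mulVec (y (m - 1))) :
    (∀ m : ℤ, (Even m → y m ∈ Veven) ∧ (Odd m → y m ∈ Vodd)) ↔ y (n : ℤ) ∈ Veven := by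
  subst hVeven hVodd
  simp only [span_single_mem n Even, span_single_mem n Odd]
  constructor
  · intro h
    exact (h n).1 (by exact_mod_cast hne)
  · intro h
    have key := core n hne (fun m => extZ (y m))
      (fun m k hk => by simp [extZ, not_lt.2 hk])
      (fun m k hk => by
        have h1 := congrFun (hy m) ⟨k, hk⟩
        rw [Pi.smul_apply, row_mul E F hFdef hEdef, hJdef] at h1
        simp only [Pi.sub_apply, Pi.smul_apply, Matrix.mulVec_diagonal, smul_eq_mul] at h1
        rw [← h1]
        simp only [extZ, dif_pos hk]
        ring)
      (fun k hk => by
        simp only [extZ]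
        split_ifs with hkn
        · apply h
          rw [Nat.even_iff] at hne ⊢
          rw [Int.even_iff] at hk
          simp only
          omega
        · rfl)
    have key2 : ∀ (m : ℤ) (i : Fin n), Even (m + (i : ℕ)) → y m i = 0 := by
      intro m i hi
      have := key m i hi
      simpa [extZ] using this
    intro m
    refine ⟨fun hm i hi => key2 m i ?_, fun hm i hi => key2 m i ?_⟩
    · rw [Nat.even_iff] at hi
      rw [Int.even_iff] at hm ⊢
      omega
    · rw [Nat.odd_iff] at hi
      rw [Int.odd_iff] at hm
      rw [Int.even_iff]
      omega
end

section
/- The characteristic polynomial of the n×n matrix E + F equals ∏_{i=1}^{n} (X − (n+1−2i)); consequently E + F is diagonalizable with the n distinct integer eigenvalues n−1, n−3, …, 3−n, 1−n (so E + F is conjugate to H = [E,F]), and E + F is invertible if and only if n is even. -/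
open Polynomial in
/-- Generating polynomial of the left eigenvectors. -/
noncomputable def kraw (a k : ℕ) : Polynomial ℂ := (1 + X) ^ a * (1 - X) ^ k

open Polynomial in
lemma kraw_ode (a k : ℕ) :
    derivative (kraw a k) - derivative (kraw a k) * X * X
      = C ((a : ℂ) - k) * kraw a k - C ((a : ℂ) + k) * (kraw a k * X) := by
  have h1 : (1 + X) * derivative ((1 + X : ℂ[X]) ^ a) = C (a : ℂ) * (1 + X) ^ a := by
    cases a with
    | zero => simp
    | succ a => rw [derivative_pow]; simp; ring
  have h2 : (1 - X) * derivative ((1 - X : ℂ[X]) ^ k) = - C (k : ℂ) * (1 - X) ^ k := by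
    cases k with
    | zero => simp
    | succ k => rw [derivative_pow]; simp; ring
  unfold kraw
  rw [derivative_mul, C_sub, C_add]
  linear_combination (1 - X) ^ (k + 1) * h1 + (1 + X) ^ (a + 1) * h2

open Polynomial in
lemma kraw_rec (a k j : ℕ) :
    ((j : ℂ) + 2) * (kraw a k).coeff (j + 2)
      = ((a : ℂ) - k) * (kraw a k).coeff (j + 1) - ((a : ℂ) + k - j) * (kraw a k).coeff j := by
  have h := congrArg (fun p => p.coeff (j + 1)) (kraw_ode a k)
  simp only [coeff_sub, coeff_C_mul, coeff_mul_X, coeff_derivative] at h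
  cases j with
  | zero =>
    simp only [zero_add, coeff_mul_X_zero, coeff_mul_X] at h ⊢
    push_cast at h ⊢
    simp [coeff_derivative] at h
    linear_combination h
  | succ j =>
    simp only [coeff_mul_X, coeff_derivative] at h
    push_cast at h ⊢
    linear_combination h

open Polynomial in
lemma kraw_rec0 (a k : ℕ) :
    (kraw a k).coeff 1 = ((a : ℂ) - k) * (kraw a k).coeff 0 := by
  have h := congrArg (fun p => p.coeff 0) (kraw_ode a k)
  simp only [coeff_sub, coeff_C_mul, coeff_mul_X_zero, coeff_derivative] at h
  push_cast at h
  linear_combination h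

open Polynomial in
lemma kraw_zero (a k : ℕ) : (kraw a k).coeff 0 = 1 := by
  simp [kraw, coeff_zero_eq_eval_zero]

open Polynomial in
lemma kraw_top (a k j : ℕ) (h : a + k < j) : (kraw a k).coeff j = 0 := by
  apply coeff_eq_zero_of_natDegree_lt
  refine lt_of_le_of_lt ?_ h
  unfold kraw
  refine natDegree_mul_le.trans (add_le_add ?_ ?_)
  · refine natDegree_pow_le.trans ?_
    have : (1 + X : ℂ[X]).natDegree ≤ 1 := by compute_degree
    nlinarith
  · refine natDegree_pow_le.trans ?_
    have : (1 - X : ℂ[X]).natDegree ≤ 1 := by compute_degree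
    nlinarith

/-- Entries of the left eigenvectors. -/
noncomputable def krawp (n k j : ℕ) : ℂ := (j.factorial : ℂ) * (kraw (n - 1 - k) k).coeff j

lemma krawp_zero (n k : ℕ) : krawp n k 0 = 1 := by simp [krawp, kraw_zero]

lemma krawp_top (n k : ℕ) (hk : k < n) : krawp n k n = 0 := by
  unfold krawp; rw [kraw_top _ _ _ (by omega), mul_zero]

lemma krawp_one (n k : ℕ) (hk : k < n) :
    krawp n k 1 = ((n : ℂ) + 1 - 2 * ((k : ℂ) + 1)) * krawp n k 0 := by
  obtain ⟨a, rfl⟩ : ∃ a, n = a + k + 1 := ⟨n - 1 - k, by omega⟩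
  unfold krawp
  rw [show a + k + 1 - 1 - k = a by omega, kraw_rec0]
  simp only [Nat.factorial, Nat.cast_add, Nat.cast_one, Nat.mul_one, Nat.zero_add, Nat.reduceAdd]
  push_cast
  ring

lemma krawp_rec (n k j : ℕ) (hk : k < n) (hj : j + 1 < n) :
    krawp n k (j + 2) + ((j + 1) * (n - (j + 1)) : ℕ) * krawp n k j
      = ((n : ℂ) + 1 - 2 * ((k : ℂ) + 1)) * krawp n k (j + 1) := by
  obtain ⟨a, rfl⟩ : ∃ a, n = a + k + 1 := ⟨n - 1 - k, by omega⟩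
  unfold krawp
  rw [show a + k + 1 - 1 - k = a by omega]
  have h := kraw_rec a k j
  rw [Nat.factorial_succ (j + 1), Nat.factorial_succ j]
  rw [Nat.cast_mul (j + 1), Nat.cast_sub hj.le]
  push_cast
  linear_combination ((j : ℂ) + 1) * (j.factorial : ℂ) * h

lemma kraw_left (n : ℕ) (E F : Matrix (Fin n) (Fin n) ℂ)
    (hFdef : ∀ i j : Fin n, F i j = if (i : ℕ) = (j : ℕ) + 1 then 1 else 0)
    (hEdef : ∀ i j : Fin n, E i j =
      if (j : ℕ) = (i : ℕ) + 1 then (((j : ℕ) * (n - (j : ℕ)) : ℕ) : ℂ) else 0)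
    (k j : Fin n) :
    ∑ i : Fin n, krawp n k i * (E + F) i j
      = ((n : ℂ) + 1 - 2 * ((k : ℕ) + 1 : ℂ)) * krawp n k j := by
  obtain ⟨j, hj⟩ := j
  obtain ⟨k, hk⟩ := k
  simp only [Matrix.add_apply, hFdef, hEdef]
  simp_rw [mul_add (krawp n k _)]
  rw [Finset.sum_add_distrib]
  rw [Fin.sum_univ_eq_sum_range (fun i => krawp n k i *
      (if j = i + 1 then ((j * (n - j) : ℕ) : ℂ) else 0)) n,
    Fin.sum_univ_eq_sum_range (fun i => krawp n k i * (if i = j + 1 then (1 : ℂ) else 0)) n]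
  have h2 : ∑ i ∈ Finset.range n, krawp n k i * (if i = j + 1 then (1 : ℂ) else 0)
      = krawp n k (j + 1) := by
    simp only [mul_ite, mul_one, mul_zero, Finset.sum_ite_eq', Finset.mem_range]
    split_ifs with h
    · rfl
    · rw [show j + 1 = n by omega, krawp_top n k hk]
  rw [h2]
  cases j with
  | zero => simp [krawp_one n k hk]
  | succ j =>
    rw [← krawp_rec n k j hk hj]
    simp only [add_left_inj, mul_ite, mul_zero, Finset.sum_ite_eq, Finset.mem_range]
    rw [if_pos (by omega)]
    ring

lemma comm_diag (n : ℕ) (E F : Matrix (Fin n) (Fin n) ℂ)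
    (hFdef : ∀ i j : Fin n, F i j = if (i : ℕ) = (j : ℕ) + 1 then 1 else 0)
    (hEdef : ∀ i j : Fin n, E i j =
      if (j : ℕ) = (i : ℕ) + 1 then (((j : ℕ) * (n - (j : ℕ)) : ℕ) : ℂ) else 0) :
    E * F - F * E
      = Matrix.diagonal (fun k : Fin n => (n : ℂ) + 1 - 2 * ((k : ℕ) + 1 : ℂ)) := by
  ext ⟨i, hi⟩ ⟨j, hj⟩
  simp only [Matrix.sub_apply, Matrix.mul_apply, hFdef, hEdef, Matrix.diagonal_apply, Fin.mk.injEq]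
  rw [Fin.sum_univ_eq_sum_range (fun l => (if l = i + 1 then ((l * (n - l) : ℕ) : ℂ) else 0) *
      (if l = j + 1 then (1 : ℂ) else 0)) n,
    Fin.sum_univ_eq_sum_range (fun l => (if i = l + 1 then (1 : ℂ) else 0) *
      (if j = l + 1 then ((j * (n - j) : ℕ) : ℂ) else 0)) n]
  have h1 : ∑ l ∈ Finset.range n, (if l = i + 1 then ((l * (n - l) : ℕ) : ℂ) else 0) *
      (if l = j + 1 then (1 : ℂ) else 0) = if i = j then ((i : ℂ) + 1) * (n - (i + 1)) else 0 := by
    simp only [ite_mul, zero_mul, Finset.sum_ite_eq', Finset.mem_range, add_left_inj]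
    by_cases hij : i = j
    · subst hij
      by_cases h : i + 1 < n
      · simp [h, Nat.cast_sub h.le]
      · have : n = i + 1 := by omega
        subst this; simp
    · simp [hij]
  have h2 : ∑ l ∈ Finset.range n, (if i = l + 1 then (1 : ℂ) else 0) *
      (if j = l + 1 then ((j * (n - j) : ℕ) : ℂ) else 0)
      = if i = j then (i : ℂ) * (n - i) else 0 := by
    cases i with
    | zero =>
      have : ∀ l, ¬ (0 = l + 1) := by omega
      simp [this]
    | succ i =>
      simp only [ite_mul, zero_mul, add_left_inj, Finset.sum_ite_eq, Finset.mem_range]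
      rw [if_pos (by omega)]
      by_cases hij : i + 1 = j
      · subst hij; simp [Nat.cast_sub hj.le]
      · simp [hij, Ne.symm hij]
  rw [h1, h2]
  split_ifs <;> ring

/-- For the irreducible sl₂-triple (E, H, F) acting on ℂ^n ≅ Sym^{n−1}ℂ², the
characteristic polynomial of E + F is ∏_{i=1}^{n} (X − (n+1−2i)); consequently
E + F is diagonalizable with the n distinct integer eigenvalues
n−1, n−3, …, 1−n (so E + F is conjugate to H = [E,F]), and E + F is invertible
if and only if n is even. -/
theorem stmt_19 (n : ℕ) (hn : 2 ≤ n)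
    (E F : Matrix (Fin n) (Fin n) ℂ)
    (hFdef : ∀ i j : Fin n, F i j = if (i : ℕ) = (j : ℕ) + 1 then 1 else 0)
    (hEdef : ∀ i j : Fin n, E i j =
      if (j : ℕ) = (i : ℕ) + 1 then (((j : ℕ) * (n - (j : ℕ)) : ℕ) : ℂ) else 0) :
    (E + F).charpoly
      = ∏ i : Fin n, (Polynomial.X - Polynomial.C ((n : ℂ) + 1 - 2 * ((i : ℕ) + 1 : ℂ)))
    ∧ (∃ (P : Matrix (Fin n) (Fin n) ℂ) (D : Fin n → ℂ),
        IsUnit P.det ∧ Function.Injective D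
        ∧ Set.range D = {x : ℂ | ∃ i : Fin n, x = (n : ℂ) + 1 - 2 * ((i : ℕ) + 1 : ℂ)}
        ∧ E + F = P * Matrix.diagonal D * P⁻¹)
    ∧ (∃ Q : Matrix (Fin n) (Fin n) ℂ,
        IsUnit Q.det ∧ E + F = Q * (E * F - F * E) * Q⁻¹)
    ∧ (IsUnit (E + F).det ↔ Even n) := by
  set D : Fin n → ℂ := fun k => (n : ℂ) + 1 - 2 * ((k : ℕ) + 1 : ℂ) with hD
  have hDinj : Function.Injective D := by
    intro a b h
    simp only [hD] at h
    have h' : ((a : ℕ) : ℂ) = ((b : ℕ) : ℂ) := by linear_combination (-1 / 2 : ℂ) * h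
    exact Fin.ext (by exact_mod_cast h')
  let V : Matrix (Fin n) (Fin n) ℂ := Matrix.of fun k j => krawp n k j
  have hVA : V * (E + F) = Matrix.diagonal D * V := by
    ext k j
    rw [Matrix.diagonal_mul, Matrix.mul_apply]
    exact kraw_left n E F hFdef hEdef k j
  have hVli : LinearIndependent ℂ V.row := by
    refine Module.End.eigenvectors_linearIndependent' (Matrix.toLin' (E + F).transpose) D hDinj
      V.row ?_
    intro k
    rw [Module.End.hasEigenvector_iff, Module.End.mem_eigenspace_iff]
    constructor
    · ext j
      have := congrFun (congrFun hVA k) j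
      rw [Matrix.diagonal_mul, Matrix.mul_apply] at this
      simp only [Matrix.toLin'_apply, Matrix.mulVec_transpose, Matrix.vecMul, dotProduct,
        Matrix.row, Pi.smul_apply, smul_eq_mul]
      exact this
    · intro h
      have := congrFun h ⟨0, by omega⟩
      simp [V, Matrix.row, krawp_zero] at this
  have hVu : IsUnit V := Matrix.linearIndependent_rows_iff_isUnit.mp hVli
  have hVd : IsUnit V.det := (Matrix.isUnit_iff_isUnit_det V).mp hVu
  have hAeq : E + F = V⁻¹ * Matrix.diagonal D * (V⁻¹)⁻¹ := by
    rw [Matrix.nonsing_inv_nonsing_inv V hVd, Matrix.mul_assoc, ← hVA, ← Matrix.mul_assoc,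
      Matrix.nonsing_inv_mul V hVd, Matrix.one_mul]
  have hVid : IsUnit (V⁻¹).det := Matrix.isUnit_nonsing_inv_det V hVd
  have hchar : (E + F).charpoly = ∏ i : Fin n, (Polynomial.X - Polynomial.C (D i)) := by
    have hVi : IsUnit V⁻¹ := (Matrix.isUnit_iff_isUnit_det _).mpr hVid
    obtain ⟨u, hu⟩ := hVi
    rw [hAeq, ← hu, Matrix.charpoly_units_conj, Matrix.charpoly_diagonal]
  have hdet : (E + F).det = ∏ i, D i := by
    rw [hAeq, Matrix.det_conj ((Matrix.isUnit_iff_isUnit_det _).mpr hVid), Matrix.det_diagonal]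
  refine ⟨hchar, ⟨V⁻¹, D, hVid, hDinj, ?_, hAeq⟩, ⟨V⁻¹, hVid, ?_⟩, ?_⟩
  · ext x
    simp only [Set.mem_range, Set.mem_ofPred_eq, hD, eq_comm]
  · rw [comm_diag n E F hFdef hEdef]; exact hAeq
  · rw [hdet, isUnit_iff_ne_zero, Finset.prod_ne_zero_iff]
    constructor
    · intro h
      by_contra hodd
      rw [Nat.not_even_iff_odd] at hodd
      obtain ⟨m, rfl⟩ := hodd
      refine h ⟨m, by omega⟩ (Finset.mem_univ _) ?_
      simp only [hD]
      push_cast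
      ring
    · rintro ⟨m, rfl⟩ i - h
      simp only [hD] at h
      have h' : ((m + m + 1 : ℕ) : ℂ) = ((2 * ((i : ℕ) + 1) : ℕ) : ℂ) := by
        push_cast at h ⊢
        linear_combination h
      have h'' : m + m + 1 = 2 * ((i : ℕ) + 1) := by exact_mod_cast h'
      omega
end
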